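/- arXiv:1302.0050 — 2 statements merged into one kernel-verified Lean document; each statement's English description precedes it below -/
import Mathlib

section
/- The average distortion class rate-distortion function dominates the worst-case Wyner–Ziv rate: R_a(D|E) ≥ max_{W ∈ 𝒲₁(E)} R_WZ(D|W). -/
open scoped BigOperators

noncomputable section

namespace UWZ

/-- real-valued indicator of a proposition. -/
def ind (p : Prop) : ℝ := @ite ℝ p (Classical.propDecidable p) 1 0

/-- `P` is a probability distribution on the finite type `A`. -/
def IsDist {A : Type*} [Fintype A] (P : A → ℝ) : Prop :=
  (∀ a, 0 ≤ P a) ∧ ∑ a, P a = 1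

/-- `W` is a channel from `A` to `B`. -/
def IsChannel {A B : Type*} [Fintype A] [Fintype B] (W : A → B → ℝ) : Prop :=
  ∀ a, IsDist (W a)

/-- the `n`-fold i.i.d. extension of `P`. -/
def iid {A : Type*} (P : A → ℝ) (n : ℕ) (xs : Fin n → A) : ℝ := ∏ t, P (xs t)

/-- the memoryless (`n`-fold i.i.d.) extension of a channel. -/
def memoryless {A B : Type*} (W : A → B → ℝ) (n : ℕ)
    (xs : Fin n → A) (ys : Fin n → B) : ℝ :=
  ∏ t, W (xs t) (ys t)

/-- the additive (per-letter, normalized) extension of a distortion measure. -/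
def dseq {A B : Type*} (d : A → B → ℝ) (n : ℕ) (xs : Fin n → A) (ys : Fin n → B) : ℝ :=
  (∑ t, d (xs t) (ys t)) / n

/-- Shannon entropy (in bits). -/
def ent {A : Type*} [Fintype A] (P : A → ℝ) : ℝ := -∑ a, P a * Real.logb 2 (P a)

/-- mutual information of a joint distribution on `A × B` (in bits). -/
def mutInf {A B : Type*} [Fintype A] [Fintype B] (J : A × B → ℝ) : ℝ :=
  ent (fun a => ∑ b, J (a, b)) + ent (fun b => ∑ a, J (a, b)) - ent J

section WZ

variable {X Y Xh : Type*} [Fintype X] [Fintype Y] [Fintype Xh] [DecidableEq Y]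

/-- expected per-letter side-information distortion `e(P,W)` of channel `W`. -/
def eDist (P : X → ℝ) (e : X → Y → ℝ) (W : X → Y → ℝ) : ℝ :=
  ∑ x, ∑ y, P x * W x y * e x y

/-- the class `𝒲₁(E)` of single-letter channels. -/
def W1 (P : X → ℝ) (e : X → Y → ℝ) (E : ℝ) : Set (X → Y → ℝ) :=
  {W | IsChannel W ∧ eDist P e W ≤ E}

/-- `d(V,W)`: expected reproduction distortion for a test channel `V` whose output
alphabet `𝒰` is the set of functions from `Y` to `Xh`. -/
def dVW (P : X → ℝ) (d : X → Xh → ℝ) (V : X → (Y → Xh) → ℝ) (W : X → Y → ℝ) : ℝ :=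
  ∑ u : Y → Xh, ∑ x, ∑ y, P x * V x u * W x y * d x (u y)

/-- `φ(V,W) = I(U;X) − I(U;Y)` under the joint law `P_X(x)V(u|x)W(y|x)`. -/
def phi (P : X → ℝ) (V : X → (Y → Xh) → ℝ) (W : X → Y → ℝ) : ℝ :=
  mutInf (fun p : (Y → Xh) × X => P p.2 * V p.2 p.1) -
    mutInf (fun p : (Y → Xh) × Y => ∑ x, P x * V x p.1 * W x p.2)

/-- `𝒱(W,D)`. -/
def Vset (P : X → ℝ) (d : X → Xh → ℝ) (W : X → Y → ℝ) (D : ℝ) :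
    Set (X → (Y → Xh) → ℝ) :=
  {V | IsChannel V ∧ dVW P d V W ≤ D}

/-- `𝒱(E,D)`. -/
def Vrob (P : X → ℝ) (e : X → Y → ℝ) (d : X → Xh → ℝ) (E D : ℝ) :
    Set (X → (Y → Xh) → ℝ) :=
  {V | IsChannel V ∧ ∀ W ∈ W1 P e E, dVW P d V W ≤ D}

/-- the Wyner–Ziv rate-distortion function `R_WZ(D|W)`. -/
def RWZ (P : X → ℝ) (d : X → Xh → ℝ) (D : ℝ) (W : X → Y → ℝ) : ℝ :=
  sInf ((fun V => phi P V W) '' Vset P d W D)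

/-- the pseudo rate-distortion function `R̃_WZ(D|W,E)`. -/
def RWZt (P : X → ℝ) (e : X → Y → ℝ) (d : X → Xh → ℝ) (D E : ℝ) (W : X → Y → ℝ) : ℝ :=
  sInf ((fun V => phi P V W) '' Vrob P e d E D)

end WZ

/-- a (possibly stochastic) Wyner–Ziv code of blocklength `n`:
a stochastic encoder `enc : 𝒳ⁿ → ℳ` and a decoder `dec : ℳ × 𝒴ⁿ → 𝒳̂ⁿ`. -/
structure Code (X Y Xh : Type*) [Fintype X] (n : ℕ) where
  M : ℕ
  Mpos : 0 < M
  enc : (Fin n → X) → Fin M → ℝ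
  enc_channel : IsChannel enc
  dec : Fin M → (Fin n → Y) → Fin n → Xh

section Codes

variable {X Y Xh : Type*} [Fintype X] [Fintype Y] [Fintype Xh]

/-- expected reproduction distortion of a code over the channel `Wn`. -/
def Code.expDist {n : ℕ} (C : Code X Y Xh n) (P : X → ℝ) (d : X → Xh → ℝ)
    (Wn : (Fin n → X) → (Fin n → Y) → ℝ) : ℝ :=
  ∑ xs, ∑ ys, ∑ m, iid P n xs * Wn xs ys * C.enc xs m * dseq d n xs (C.dec m ys)

/-- probability that the reproduction distortion of a code exceeds `D`, over channel `Wn`. -/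
def Code.excessProb {n : ℕ} (C : Code X Y Xh n) (P : X → ℝ) (d : X → Xh → ℝ)
    (Wn : (Fin n → X) → (Fin n → Y) → ℝ) (D : ℝ) : ℝ :=
  ∑ xs, ∑ ys, ∑ m, iid P n xs * Wn xs ys * C.enc xs m * ind (D < dseq d n xs (C.dec m ys))

/-- a sequence of channels from `X`-sequences to `Y`-sequences. -/
abbrev ChannelSeq (X Y : Type*) := ∀ n : ℕ, (Fin n → X) → (Fin n → Y) → ℝ

/-- probability that the side-information distortion exceeds `E`. -/
def excessSideProb (P : X → ℝ) (e : X → Y → ℝ) {n : ℕ}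
    (Wn : (Fin n → X) → (Fin n → Y) → ℝ) (E : ℝ) : ℝ :=
  ∑ xs, ∑ ys, iid P n xs * Wn xs ys * ind (E < dseq e n xs ys)

/-- expected side-information distortion at blocklength `n`. -/
def avgSideDist (P : X → ℝ) (e : X → Y → ℝ) {n : ℕ}
    (Wn : (Fin n → X) → (Fin n → Y) → ℝ) : ℝ :=
  ∑ xs, ∑ ys, iid P n xs * Wn xs ys * dseq e n xs ys

/-- the maximum distortion constrained class `𝒲_m(E)`. -/
def MaxClass (P : X → ℝ) (e : X → Y → ℝ) (E : ℝ) : Set (ChannelSeq X Y) :=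
  {Wseq | (∀ n, IsChannel (Wseq n)) ∧
    ∀ δ > (0:ℝ), ∃ n0 : ℕ, ∀ n ≥ n0, excessSideProb P e (Wseq n) E ≤ δ}

/-- the average distortion constrained class `𝒲_a(E)`. -/
def AvgClass (P : X → ℝ) (e : X → Y → ℝ) (E : ℝ) : Set (ChannelSeq X Y) :=
  {Wseq | (∀ n, IsChannel (Wseq n)) ∧ ∀ n, 1 ≤ n → avgSideDist P e (Wseq n) ≤ E}

/-- `R` is an achievable rate at distortion level `D`, universally for the class `WC`
of channel sequences. -/
def Achievable (P : X → ℝ) (d : X → Xh → ℝ) (WC : Set (ChannelSeq X Y)) (D R : ℝ) : Prop :=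
  ∀ ε > (0:ℝ), ∃ n0 : ℕ, ∃ C : ∀ n, Code X Y Xh n, ∀ n ≥ n0,
    Real.logb 2 ((C n).M : ℝ) / (n : ℝ) ≤ R + ε ∧
    ∀ Wseq ∈ WC, (C n).expDist P d (Wseq n) ≤ D + ε

/-- the rate-distortion function `R_m(D|E)` of the maximum distortion constrained class. -/
def Rm (P : X → ℝ) (e : X → Y → ℝ) (d : X → Xh → ℝ) (D E : ℝ) : ℝ :=
  sInf {R | Achievable P d (MaxClass P e E) D R}

/-- the rate-distortion function `R_a(D|E)` of the average distortion constrained class. -/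
def Ra (P : X → ℝ) (e : X → Y → ℝ) (d : X → Xh → ℝ) (D E : ℝ) : ℝ :=
  sInf {R | Achievable P d (AvgClass P e E) D R}

end Codes

/-- a Heegard–Berger code: one encoder and two decoders. -/
structure HBCode (X Y Xh : Type*) (n : ℕ) where
  M : ℕ
  Mpos : 0 < M
  enc : (Fin n → X) → Fin M
  dec1 : Fin M → (Fin n → Y) → Fin n → Xh
  dec2 : Fin M → (Fin n → Y) → Fin n → Xh

section HB

variable {X Y Xh : Type*} [Fintype X] [Fintype Y] [Fintype Xh]

/-- expected distortion of one branch of a Heegard–Berger code over the memoryless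
extension of the single-letter channel `W`. -/
def hbExpDist {n M : ℕ} (P : X → ℝ) (d : X → Xh → ℝ) (W : X → Y → ℝ)
    (enc : (Fin n → X) → Fin M) (dec : Fin M → (Fin n → Y) → Fin n → Xh) : ℝ :=
  ∑ xs, ∑ ys, iid P n xs * memoryless W n xs ys * dseq d n xs (dec (enc xs) ys)

/-- achievability for the Heegard–Berger problem with side-information channels `W₁, W₂`. -/
def HBAchievable (P : X → ℝ) (d : X → Xh → ℝ) (W₁ W₂ : X → Y → ℝ) (D₁ D₂ R : ℝ) : Prop :=
  ∀ ε > (0:ℝ), ∃ n0 : ℕ, ∃ C : ∀ n, HBCode X Y Xh n, ∀ n ≥ n0,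
    Real.logb 2 ((C n).M : ℝ) / (n : ℝ) ≤ R + ε ∧
    hbExpDist P d W₁ (C n).enc (C n).dec1 ≤ D₁ + ε ∧
    hbExpDist P d W₂ (C n).enc (C n).dec2 ≤ D₂ + ε

/-- the Heegard–Berger rate-distortion function `R_HB(D₁,D₂|W₁,W₂)`. -/
def RHB (P : X → ℝ) (d : X → Xh → ℝ) (W₁ W₂ : X → Y → ℝ) (D₁ D₂ : ℝ) : ℝ :=
  sInf {R | HBAchievable P d W₁ W₂ D₁ D₂ R}

end HB

/-- the classical (no side-information) rate-distortion function `R(D)`. -/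
def RD {X Xh : Type*} [Fintype X] [Fintype Xh] (P : X → ℝ) (d : X → Xh → ℝ) (D : ℝ) : ℝ :=
  sInf ((fun Q : X → Xh → ℝ => mutInf fun p : X × Xh => P p.1 * Q p.1 p.2) ''
    {Q | IsChannel Q ∧ (∑ x, ∑ xh, P x * Q x xh * d x xh) ≤ D})

section Types

variable {X Y : Type*} [Fintype X] [Fintype Y] [DecidableEq X] [DecidableEq Y]

/-- the empirical distribution (type) `P_{x^n}` of a sequence. -/
def empDist {n : ℕ} (xs : Fin n → X) (a : X) : ℝ :=
  ((Finset.univ.filter fun t => xs t = a).card : ℝ) / n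

/-- the joint empirical distribution (joint type) of a pair of sequences. -/
def empJoint {n : ℕ} (xs : Fin n → X) (ys : Fin n → Y) (p : X × Y) : ℝ :=
  ((Finset.univ.filter fun t => xs t = p.1 ∧ ys t = p.2).card : ℝ) / n

/-- `x^n` is `P`-typical with constant `δ`. -/
def isTypical {n : ℕ} (P : X → ℝ) (δ : ℝ) (xs : Fin n → X) : Prop :=
  (∀ a, |empDist xs a - P a| ≤ δ) ∧ ∀ t, P (xs t) ≠ 0

/-- `y^n` lies in the `W`-shell `T_W(x^n)` of `x^n`. -/
def inShell {n : ℕ} (xs : Fin n → X) (ys : Fin n → Y) (W : X → Y → ℝ) : Prop :=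
  ∀ a b, empJoint xs ys (a, b) = empDist xs a * W a b

/-- cardinality of the `W`-shell of `x^n`. -/
def shellCard {n : ℕ} (xs : Fin n → X) (W : X → Y → ℝ) : ℕ :=
  Set.ncard {ys : Fin n → Y | inShell xs ys W}

end Types

/-- `W` is a conditional type with denominator `n` (all entries are multiples of `1/n`). -/
def isCondType {X Y : Type*} (n : ℕ) (W : X → Y → ℝ) : Prop :=
  ∀ x y, ∃ k : ℕ, W x y = (k : ℝ) / n

section Perm

variable {X Y Xh : Type*} [Fintype X] [Fintype Y] [Fintype Xh]

/-- probability, under the permuted source/side-information pair, that the reproduction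
distortion of the code `C` exceeds `D`. -/
def permExcess {n : ℕ} (Pxy : (Fin n → X) × (Fin n → Y) → ℝ) (C : Code X Y Xh n)
    (d : X → Xh → ℝ) (D : ℝ) (π : Equiv.Perm (Fin n)) : ℝ :=
  ∑ p : (Fin n → X) × (Fin n → Y), ∑ m,
    Pxy p * C.enc (p.1 ∘ π) m * ind (D < dseq d n (p.1 ∘ π) (C.dec m (p.2 ∘ π)))

end Perm


/-! ### Auxiliary material for the proof -/

section Aux

open Real

/-- unnormalized `H(X) - H(Y)` functional (natural logarithms). -/
def gh {A B : Type*} [Fintype A] [Fintype B] (W : A → B → ℝ) (μ : A → ℝ) : ℝ :=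
  ∑ x, negMulLog (μ x) - ∑ y, negMulLog (∑ x, μ x * W x y)

theorem hterm_aux {a b A B : ℝ} (ha : 0 ≤ a) (hb : 0 ≤ b) (hab : 0 < a → 0 < b)
    (haA : a ≤ A) (hbB : b ≤ B) :
    negMulLog a + a * log b ≤ a * (log B - log A) + (b * (A / B) - a) := by
  rcases ha.eq_or_lt with rfl | ha'
  · have : 0 ≤ b * (A / B) := mul_nonneg hb (div_nonneg haA (hb.trans hbB))
    simpa using this
  · have hb' := hab ha'
    have hA : 0 < A := ha'.trans_le haA
    have hB : 0 < B := hb'.trans_le hbB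
    have h := log_le_sub_one_of_pos (x := b * A / (a * B)) (by positivity)
    rw [log_div (by positivity) (by positivity), log_mul hb'.ne' hA.ne',
      log_mul ha'.ne' hB.ne'] at h
    have h2 := mul_le_mul_of_nonneg_left h ha
    have h3 : a * (b * A / (a * B) - 1) = b * (A / B) - a := by
      field_simp
    rw [h3] at h2
    unfold negMulLog
    linarith

theorem hterm_superadd {a₁ b₁ a₂ b₂ : ℝ} (ha₁ : 0 ≤ a₁) (hb₁ : 0 ≤ b₁) (h₁ : 0 < a₁ → 0 < b₁)
    (ha₂ : 0 ≤ a₂) (hb₂ : 0 ≤ b₂) (h₂ : 0 < a₂ → 0 < b₂) :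
    (negMulLog a₁ + a₁ * log b₁) + (negMulLog a₂ + a₂ * log b₂) ≤
      negMulLog (a₁ + a₂) + (a₁ + a₂) * log (b₁ + b₂) := by
  have e1 := hterm_aux (A := a₁ + a₂) (B := b₁ + b₂) ha₁ hb₁ h₁ (by linarith) (by linarith)
  have e2 := hterm_aux (A := a₁ + a₂) (B := b₁ + b₂) ha₂ hb₂ h₂ (by linarith) (by linarith)
  have e3 : b₁ * ((a₁ + a₂) / (b₁ + b₂)) + b₂ * ((a₁ + a₂) / (b₁ + b₂)) ≤ a₁ + a₂ := by
    rcases (add_nonneg hb₁ hb₂).eq_or_lt with h | h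
    · rw [← h]; simp; linarith
    · apply le_of_eq; field_simp
  unfold negMulLog at *
  linarith

theorem gh_eq {A B : Type*} [Fintype A] [Fintype B] {W : A → B → ℝ} (hW : IsChannel W)
    (μ : A → ℝ) :
    gh W μ = ∑ x, ∑ y, W x y * (negMulLog (μ x) + μ x * log (∑ x', μ x' * W x' y)) := by
  unfold gh
  have h1 : ∀ x, negMulLog (μ x) = ∑ y, W x y * negMulLog (μ x) := fun x => by
    rw [← Finset.sum_mul, (hW x).2, one_mul]
  have h2 : ∑ y, negMulLog (∑ x, μ x * W x y) =
      - ∑ x, ∑ y, W x y * (μ x * log (∑ x', μ x' * W x' y)) := by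
    rw [Finset.sum_comm, ← Finset.sum_neg_distrib]
    refine Finset.sum_congr rfl fun y _ => ?_
    rw [negMulLog, neg_mul, Finset.sum_mul]
    congr 1
    refine Finset.sum_congr rfl fun x _ => ?_
    ring
  rw [h2, Finset.sum_congr rfl fun x _ => h1 x, sub_neg_eq_add, ← Finset.sum_add_distrib]
  refine Finset.sum_congr rfl fun x _ => ?_
  rw [← Finset.sum_add_distrib]
  refine Finset.sum_congr rfl fun y _ => ?_
  ring

theorem gh_add {A B : Type*} [Fintype A] [Fintype B] {W : A → B → ℝ} (hW : IsChannel W)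
    {μ ν : A → ℝ} (hμ : ∀ x, 0 ≤ μ x) (hν : ∀ x, 0 ≤ ν x) :
    gh W μ + gh W ν ≤ gh W (fun x => μ x + ν x) := by
  rw [gh_eq hW, gh_eq hW, gh_eq hW, ← Finset.sum_add_distrib]
  refine Finset.sum_le_sum fun x _ => ?_
  rw [← Finset.sum_add_distrib]
  refine Finset.sum_le_sum fun y _ => ?_
  rcases ((hW x).1 y).eq_or_lt with h | h
  · rw [← h]; simp
  · rw [← mul_add]
    refine mul_le_mul_of_nonneg_left ?_ h.le
    have key : ∀ κ : A → ℝ, (∀ x, 0 ≤ κ x) → 0 ≤ ∑ x', κ x' * W x' y ∧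
        (0 < κ x → 0 < ∑ x', κ x' * W x' y) := fun κ hκ => by
      have h0 : ∀ x' ∈ Finset.univ, 0 ≤ κ x' * W x' y :=
        fun x' _ => mul_nonneg (hκ x') ((hW x').1 y)
      refine ⟨Finset.sum_nonneg h0, fun hp => ?_⟩
      exact lt_of_lt_of_le (mul_pos hp h)
        (Finset.single_le_sum (f := fun x' => κ x' * W x' y) h0 (Finset.mem_univ x))
    simp only [add_mul, Finset.sum_add_distrib]
    have := hterm_superadd (hμ x) (key μ hμ).1 (key μ hμ).2 (hν x) (key ν hν).1 (key ν hν).2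
    simpa only [add_mul] using this

theorem gh_zero {A B : Type*} [Fintype A] [Fintype B] (W : A → B → ℝ) :
    gh W (fun _ => 0) = 0 := by
  simp [gh]

theorem gh_smul {A B : Type*} [Fintype A] [Fintype B] {W : A → B → ℝ} (hW : IsChannel W)
    (c : ℝ) (μ : A → ℝ) : gh W (fun x => c * μ x) = c * gh W μ := by
  unfold gh
  have h1 : ∀ y, ∑ x, c * μ x * W x y = c * ∑ x, μ x * W x y := fun y => by
    rw [Finset.mul_sum]; exact Finset.sum_congr rfl fun x _ => by ring
  simp only [h1, negMulLog_mul, Finset.sum_add_distrib, ← Finset.mul_sum, ← Finset.sum_mul]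
  have h2 : ∑ y, ∑ x, μ x * W x y = ∑ x, μ x := by
    rw [Finset.sum_comm]
    refine Finset.sum_congr rfl fun x _ => ?_
    rw [← Finset.mul_sum, (hW x).2, mul_one]
  rw [h2]; ring

theorem gh_sum {A B ι : Type*} [Fintype A] [Fintype B] {W : A → B → ℝ} (hW : IsChannel W)
    (s : Finset ι) (μ : ι → A → ℝ) (hμ : ∀ i x, 0 ≤ μ i x) :
    ∑ i ∈ s, gh W (μ i) ≤ gh W (fun x => ∑ i ∈ s, μ i x) := by
  classical
  induction s using Finset.induction_on with
  | empty => simp [gh_zero]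
  | insert a s ha ih =>
    simp only [Finset.sum_insert ha]
    exact (add_le_add le_rfl ih).trans
      (gh_add hW (hμ a) (fun x => Finset.sum_nonneg fun i _ => hμ i x))

/-- achievable triples of (marginal, distortion, functional). -/
def Good {X Y Xh : Type*} [Fintype X] [Fintype Y] [Fintype Xh] [DecidableEq Y]
    (W : X → Y → ℝ) (d : X → Xh → ℝ) (ρ : X → ℝ) (δ γ : ℝ) : Prop :=
  ∃ ν : (Y → Xh) → X → ℝ, (∀ u x, 0 ≤ ν u x) ∧ (∀ x, ∑ u, ν u x = ρ x) ∧
    (∑ u, ∑ x, ∑ y, ν u x * W x y * d x (u y) = δ) ∧ γ ≤ ∑ u, gh W (ν u)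

section good
variable {X Y Xh : Type*} [Fintype X] [Fintype Y] [Fintype Xh] [DecidableEq Y]
  {W : X → Y → ℝ} {d : X → Xh → ℝ}

theorem Good.zero : Good W d (fun _ => 0) 0 0 :=
  ⟨fun _ _ => 0, by simp, by simp, by simp, by simp [gh_zero]⟩

theorem Good.add (hW : IsChannel W) {ρ₁ ρ₂ : X → ℝ} {δ₁ δ₂ γ₁ γ₂ : ℝ}
    (h₁ : Good W d ρ₁ δ₁ γ₁) (h₂ : Good W d ρ₂ δ₂ γ₂) :
    Good W d (fun x => ρ₁ x + ρ₂ x) (δ₁ + δ₂) (γ₁ + γ₂) := by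
  obtain ⟨ν₁, a1, b1, c1, e1⟩ := h₁
  obtain ⟨ν₂, a2, b2, c2, e2⟩ := h₂
  refine ⟨fun u x => ν₁ u x + ν₂ u x, fun u x => add_nonneg (a1 u x) (a2 u x), ?_, ?_, ?_⟩
  · intro x; rw [Finset.sum_add_distrib, b1, b2]
  · rw [← c1, ← c2]; simp only [add_mul, Finset.sum_add_distrib]
  · refine (add_le_add e1 e2).trans ?_
    rw [← Finset.sum_add_distrib]
    exact Finset.sum_le_sum fun u _ => gh_add hW (a1 u) (a2 u)

theorem Good.sum (hW : IsChannel W) {ι : Type*} (s : Finset ι) {ρ : ι → X → ℝ} {δ γ : ι → ℝ}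
    (h : ∀ i, Good W d (ρ i) (δ i) (γ i)) :
    Good W d (fun x => ∑ i ∈ s, ρ i x) (∑ i ∈ s, δ i) (∑ i ∈ s, γ i) := by
  classical
  induction s using Finset.induction_on with
  | empty => simpa using Good.zero
  | insert a s ha ih =>
    simp only [Finset.sum_insert ha]
    exact (h a).add hW ih

theorem Good.single (u₀ : Y → Xh) (μ : X → ℝ) (hμ : ∀ x, 0 ≤ μ x) :
    Good W d μ (∑ x, ∑ y, μ x * W x y * d x (u₀ y)) (gh W μ) := by
  classical
  refine ⟨fun u x => if u = u₀ then μ x else 0, ?_, ?_, ?_, ?_⟩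
  · intro u x; dsimp only; split_ifs; exacts [hμ x, le_rfl]
  · intro x; simp
  · rw [Finset.sum_eq_single u₀]
    · simp
    · intro b _ hb; simp [hb]
    · simp
  · rw [Finset.sum_eq_single u₀]
    · simp
    · intro b _ hb; simp [hb, gh_zero]
    · simp

theorem Good.mono {ρ ρ' : X → ℝ} {δ δ' γ γ' : ℝ} (h : Good W d ρ δ γ)
    (h1 : ∀ x, ρ x = ρ' x) (h2 : δ = δ') (h3 : γ' ≤ γ) : Good W d ρ' δ' γ' := by
  obtain ⟨ν, a, b, c, e⟩ := h
  exact ⟨ν, a, fun x => (b x).trans (h1 x), c.trans h2, h3.trans e⟩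

end good

theorem sum_cons {Z : Type*} [Fintype Z] {n : ℕ} (F : (Fin (n+1) → Z) → ℝ) :
    ∑ z, F z = ∑ z0, ∑ zs : Fin n → Z, F (Fin.cons z0 zs) := by
  rw [← Fintype.sum_prod_type']
  exact (Fintype.sum_equiv (Fin.consEquiv fun _ => Z) _ _ fun p => rfl).symm

theorem memoryless_cons {A B : Type*} (W : A → B → ℝ) (n : ℕ) (x : A) (y : B)
    (xs : Fin n → A) (ys : Fin n → B) :
    memoryless W (n+1) (Fin.cons x xs) (Fin.cons y ys) = W x y * memoryless W n xs ys := by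
  simp [memoryless, Fin.prod_univ_succ]

theorem sum_prod_eq_one {Z : Type*} [Fintype Z] {n : ℕ} (q : Fin n → Z → ℝ)
    (hq : ∀ t, ∑ z, q t z = 1) : ∑ z : Fin n → Z, ∏ t, q t (z t) = 1 := by
  classical
  rw [← Fintype.prod_sum]; simp [hq]

theorem memoryless_channel {A B : Type*} [Fintype A] [Fintype B] {W : A → B → ℝ}
    (hW : IsChannel W) (n : ℕ) : IsChannel (memoryless W n) := fun xs =>
  ⟨fun ys => Finset.prod_nonneg fun t _ => (hW _).1 _,
    sum_prod_eq_one (fun t => W (xs t)) fun t => (hW _).2⟩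

theorem sum_prod_mul_sum {Z : Type*} [Fintype Z] {n : ℕ} (q f : Fin n → Z → ℝ)
    (hq : ∀ t, ∑ z, q t z = 1) :
    ∑ z : Fin n → Z, (∏ t, q t (z t)) * ∑ t, f t (z t) = ∑ t, ∑ z, q t z * f t z := by
  induction n with
  | zero => simp
  | succ n ih =>
    rw [sum_cons, Fin.sum_univ_succ]
    simp only [Fin.prod_univ_succ, Fin.sum_univ_succ, Fin.cons_zero, Fin.cons_succ]
    have h1 := ih (fun t => q t.succ) (fun t => f t.succ) fun t => hq _
    have h2 := sum_prod_eq_one (fun t : Fin n => q t.succ) fun t => hq _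
    have : ∀ z0, ∑ zs : Fin n → Z, q 0 z0 * (∏ t : Fin n, q t.succ (zs t)) *
        (f 0 z0 + ∑ t : Fin n, f t.succ (zs t)) =
        q 0 z0 * f 0 z0 + q 0 z0 * ∑ t : Fin n, ∑ z, q t.succ z * f t.succ z := fun z0 => by
      rw [← h1]
      calc _ = q 0 z0 * f 0 z0 * ∑ zs : Fin n → Z, (∏ t : Fin n, q t.succ (zs t)) +
          q 0 z0 * ∑ zs : Fin n → Z, (∏ t : Fin n, q t.succ (zs t)) *
            ∑ t : Fin n, f t.succ (zs t) := by
            rw [Finset.mul_sum, Finset.mul_sum, ← Finset.sum_add_distrib]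
            exact Finset.sum_congr rfl fun _ _ => by ring
        _ = _ := by rw [h2, mul_one]
    rw [Finset.sum_congr rfl fun z0 _ => this z0, Finset.sum_add_distrib, ← Finset.sum_mul, hq,
      one_mul]

theorem sum_negMulLog_iid {Z : Type*} [Fintype Z] {q : Z → ℝ} (hq : ∑ z, q z = 1) (n : ℕ) :
    ∑ z : Fin n → Z, negMulLog (iid q n z) = n * ∑ z, negMulLog (q z) := by
  have h := sum_prod_mul_sum (fun _ : Fin n => q) (fun _ z => - log (q z)) fun _ => hq
  have h1 : ∀ z : Fin n → Z, negMulLog (iid q n z) =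
      (∏ t, q (z t)) * ∑ t, - log (q (z t)) := fun z => by
    unfold negMulLog iid
    by_cases h0 : ∏ t, q (z t) = 0
    · simp [h0]
    · rw [log_prod (fun t ht => fun h => h0 (Finset.prod_eq_zero ht h)),
        Finset.sum_neg_distrib]; ring
  rw [Finset.sum_congr rfl fun z _ => h1 z, h]
  simp [negMulLog]

open Classical in
theorem good_main {X Y Xh : Type*} [Fintype X] [Fintype Y] [Fintype Xh] [DecidableEq Y]
    {W : X → Y → ℝ} {d : X → Xh → ℝ} (hW : IsChannel W) (n : ℕ) :
    ∀ (μ : (Fin n → X) → ℝ) (_ : ∀ xs, 0 ≤ μ xs) (dec : (Fin n → Y) → Fin n → Xh),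
    Good W d (fun x => ∑ xs, μ xs * ∑ t, if xs t = x then 1 else 0)
      (∑ xs, ∑ ys, μ xs * memoryless W n xs ys * ∑ t, d (xs t) (dec ys t))
      (gh (memoryless W n) μ) := by
  induction n with
  | zero =>
    intro μ hμ dec
    refine Good.zero.mono ?_ ?_ ?_
    · simp
    · simp
    · simp [gh, memoryless]
  | succ n ih =>
    intro μ hμ dec
    have hWn := memoryless_channel hW n
    have h0 : ∀ yr : Fin n → Y, ∀ x, 0 ≤ ∑ xs : Fin n → X,
        μ (Fin.cons x xs) * memoryless W n xs yr := fun yr x =>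
      Finset.sum_nonneg fun xs _ => mul_nonneg (hμ _) ((hWn _).1 _)
    have h1 := Good.sum (d := d) hW Finset.univ fun yr : Fin n → Y =>
      Good.single (W := W) (d := d) (fun y => dec (Fin.cons y yr) 0)
        (fun x => ∑ xs : Fin n → X, μ (Fin.cons x xs) * memoryless W n xs yr) (h0 yr)
    have h2 := Good.sum (d := d) hW Finset.univ fun y0 : Y =>
      ih (fun xs => ∑ x0, W x0 y0 * μ (Fin.cons x0 xs))
        (fun xs => Finset.sum_nonneg fun x0 _ => mul_nonneg ((hW _).1 _) (hμ _))
        (fun ys t => dec (Fin.cons y0 ys) t.succ)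
    refine (h1.add hW h2).mono ?_ ?_ ?_
    · intro x
      rw [sum_cons]
      simp only [Fin.sum_univ_succ, Fin.cons_zero, Fin.cons_succ, mul_add, Finset.sum_add_distrib]
      congr 1
      · rw [Finset.sum_comm]
        simp only [← Finset.mul_sum, (hWn _).2, mul_one, ← Finset.sum_mul]
        simp
      · rw [Finset.sum_comm, Finset.sum_comm (s := (Finset.univ : Finset X))]
        refine Finset.sum_congr rfl fun xs _ => ?_
        rw [← Finset.sum_mul, Finset.sum_comm, ← Finset.sum_mul]
        congr 1
        refine Finset.sum_congr rfl fun x0 _ => ?_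
        rw [← Finset.sum_mul, (hW _).2, one_mul]
    · simp only [sum_cons (n := n)]
      simp only [Fin.sum_univ_succ, Fin.cons_zero, Fin.cons_succ, memoryless_cons, mul_add,
        Finset.sum_add_distrib]
      congr 1
      · simp only [Finset.sum_mul]
        rw [Finset.sum_comm]
        refine Finset.sum_congr rfl fun x _ => ?_
        rw [Finset.sum_comm]
        rw [Finset.sum_comm (s := (Finset.univ : Finset (Fin n → X)))]
        refine Finset.sum_congr rfl fun y _ => ?_
        rw [Finset.sum_comm]
        refine Finset.sum_congr rfl fun xs _ => ?_
        refine Finset.sum_congr rfl fun ys _ => ?_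
        ring
      · simp only [Finset.sum_mul]
        rw [Finset.sum_congr rfl fun y _ => Finset.sum_congr rfl fun xs _ => Finset.sum_comm]
        rw [Finset.sum_congr rfl fun y _ => Finset.sum_comm, Finset.sum_comm]
        refine Finset.sum_congr rfl fun x _ => ?_
        rw [Finset.sum_comm]
        refine Finset.sum_congr rfl fun xs _ => ?_
        refine Finset.sum_congr rfl fun y _ => ?_
        refine Finset.sum_congr rfl fun ys _ => ?_
        ring
    · have e1 : ∑ x0, gh (memoryless W n) (fun xs => μ (Fin.cons x0 xs)) ≤
          ∑ y0, gh (memoryless W n) (fun xs => ∑ x0, W x0 y0 * μ (Fin.cons x0 xs)) := by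
        calc _ = ∑ y0, ∑ x0, gh (memoryless W n) (fun xs => W x0 y0 * μ (Fin.cons x0 xs)) := by
              rw [Finset.sum_comm]
              refine Finset.sum_congr rfl fun x0 _ => ?_
              simp only [gh_smul hWn]
              rw [← Finset.sum_mul, (hW _).2, one_mul]
          _ ≤ _ := Finset.sum_le_sum fun y0 _ =>
              gh_sum hWn _ (fun x0 xs => W x0 y0 * μ (Fin.cons x0 xs))
                fun x0 xs => mul_nonneg ((hW _).1 _) (hμ _)
      refine le_trans (le_of_eq ?_) (add_le_add le_rfl e1)
      unfold gh
      simp only [sum_cons (n := n), memoryless_cons, Finset.sum_sub_distrib]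
      rw [Finset.sum_comm (s := (Finset.univ : Finset (Fin n → Y))) (t := (Finset.univ : Finset X)),
        Finset.sum_comm (s := (Finset.univ : Finset (Fin n → Y))) (t := (Finset.univ : Finset Y))]
      have : ∀ (y : Y) (ys : Fin n → Y),
          ∑ x, ∑ xs : Fin n → X, μ (Fin.cons x xs) * (W x y * memoryless W n xs ys) =
          ∑ x, (∑ xs : Fin n → X, μ (Fin.cons x xs) * memoryless W n xs ys) * W x y :=
        fun y ys => by
          refine Finset.sum_congr rfl fun x _ => ?_
          rw [Finset.sum_mul]
          exact Finset.sum_congr rfl fun xs _ => by ring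
      simp only [this]
      ring

theorem ent_eq {A : Type*} [Fintype A] (Q : A → ℝ) : ent Q = (∑ a, negMulLog (Q a)) / log 2 := by
  unfold ent negMulLog logb
  rw [Finset.sum_div, ← Finset.sum_neg_distrib]
  exact Finset.sum_congr rfl fun a _ => by ring

theorem phi_eq {X Y Xh : Type*} [Fintype X] [Fintype Y] [Fintype Xh] [DecidableEq Y]
    {P : X → ℝ} {V : X → (Y → Xh) → ℝ} {W : X → Y → ℝ} (hV : IsChannel V) (hW : IsChannel W) :
    phi P V W = (gh W P - ∑ u, gh W (fun x => P x * V x u)) / log 2 := by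
  unfold phi mutInf gh
  simp only [ent_eq, Fintype.sum_prod_type, Finset.sum_sub_distrib]
  have h1 : ∀ x, ∑ u, P x * V x u = P x := fun x => by
    rw [← Finset.mul_sum, (hV x).2, mul_one]
  have h2 : ∀ u, ∑ y, ∑ x, P x * V x u * W x y = ∑ x, P x * V x u := fun u => by
    rw [Finset.sum_comm]
    refine Finset.sum_congr rfl fun x _ => ?_
    rw [← Finset.mul_sum, (hW x).2, mul_one]
  have h3 : ∀ y, ∑ u, ∑ x, P x * V x u * W x y = ∑ x, P x * W x y := fun y => by
    rw [Finset.sum_comm]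
    refine Finset.sum_congr rfl fun x _ => ?_
    rw [← Finset.sum_mul, h1]
  simp only [h1, h2, h3]
  ring

theorem phi_continuous {X Y Xh : Type*} [Fintype X] [Fintype Y] [Fintype Xh] [DecidableEq Y]
    (P : X → ℝ) (W : X → Y → ℝ) : Continuous fun V : X → (Y → Xh) → ℝ => phi P V W := by
  unfold phi mutInf
  simp only [ent_eq]
  fun_prop

theorem dVW_continuous {X Y Xh : Type*} [Fintype X] [Fintype Y] [Fintype Xh] [DecidableEq Y]
    (P : X → ℝ) (d : X → Xh → ℝ) (W : X → Y → ℝ) :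
    Continuous fun V : X → (Y → Xh) → ℝ => dVW P d V W := by
  unfold dVW
  fun_prop

theorem isCompact_channels {A B : Type*} [Fintype A] [Fintype B] :
    IsCompact {V : A → B → ℝ | IsChannel V} := by
  have hK : IsCompact (Set.pi Set.univ fun _ : A => Set.pi Set.univ fun _ : B => Set.Icc (0:ℝ) 1) :=
    isCompact_univ_pi fun _ => isCompact_univ_pi fun _ => isCompact_Icc
  refine hK.of_isClosed_subset ?_ ?_
  · have : {V : A → B → ℝ | IsChannel V} =
        ⋂ a, ((⋂ b, {V : A → B → ℝ | 0 ≤ V a b}) ∩ {V : A → B → ℝ | ∑ b, V a b = 1}) := by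
      ext V; simp [IsChannel, IsDist]
    rw [this]
    refine isClosed_iInter fun a => (isClosed_iInter fun b => ?_).inter ?_
    · exact isClosed_le continuous_const (by fun_prop)
    · exact isClosed_eq (by fun_prop) continuous_const
  · intro V hV a _ b _
    refine ⟨(hV a).1 b, ?_⟩
    rw [← (hV a).2]
    exact Finset.single_le_sum (fun b _ => (hV a).1 b) (Finset.mem_univ b)

theorem negMulLog_sum_le {ι : Type*} (s : Finset ι) (a : ι → ℝ) (ha : ∀ i, 0 ≤ a i) :
    negMulLog (∑ i ∈ s, a i) ≤ ∑ i ∈ s, negMulLog (a i) := by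
  have : negMulLog (∑ i ∈ s, a i) = ∑ i ∈ s, - (a i * log (∑ j ∈ s, a j)) := by
    rw [negMulLog, Finset.sum_neg_distrib, ← Finset.sum_mul]; ring
  rw [this]
  refine Finset.sum_le_sum fun i hi => ?_
  unfold negMulLog
  rcases (ha i).eq_or_lt with h | h
  · rw [← h]; simp
  · have : log (a i) ≤ log (∑ j ∈ s, a j) :=
      log_le_log h (Finset.single_le_sum (fun j _ => ha j) hi)
    nlinarith

theorem sum_negMulLog_le {M : ℕ} (a : Fin M → ℝ) (ha : ∀ i, 0 ≤ a i) :
    ∑ i, negMulLog (a i) ≤ negMulLog (∑ i, a i) + (∑ i, a i) * log M := by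
  rcases Nat.eq_zero_or_pos M with rfl | hM
  · simp
  have hM' : (0:ℝ) < M := by exact_mod_cast hM
  have h : ∀ i, negMulLog (a i) + a i * log 1 ≤
      a i * (log M - log (∑ j, a j)) + (1 * ((∑ j, a j) / M) - a i) := fun i =>
    hterm_aux (ha i) zero_le_one (fun _ => one_pos)
      (Finset.single_le_sum (fun j _ => ha j) (Finset.mem_univ i)) (by exact_mod_cast hM)
  have h2 := Finset.sum_le_sum fun i (_ : i ∈ Finset.univ) => h i
  simp only [log_one, mul_zero, add_zero, one_mul, Finset.sum_add_distrib, Finset.sum_sub_distrib,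
    ← Finset.sum_mul, Finset.sum_const, Finset.card_univ, Fintype.card_fin, nsmul_eq_mul] at h2
  have h3 : (M:ℝ) * ((∑ j, a j) / M) = ∑ j, a j := by field_simp
  rw [h3] at h2
  unfold negMulLog at *
  linarith

theorem gh_rate {A B : Type*} [Fintype A] [Fintype B] {W : A → B → ℝ} (hW : IsChannel W) {M : ℕ}
    (μ : Fin M → A → ℝ) (hμ : ∀ m x, 0 ≤ μ m x) (h1 : ∑ x, ∑ m, μ m x = 1) :
    gh W (fun x => ∑ m, μ m x) - ∑ m, gh W (μ m) ≤ log M := by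
  unfold gh
  rw [Finset.sum_sub_distrib]
  have e1 : ∑ x, negMulLog (∑ m, μ m x) ≤ ∑ m, ∑ x, negMulLog (μ m x) := by
    rw [Finset.sum_comm]
    exact Finset.sum_le_sum fun x _ => negMulLog_sum_le _ _ fun m => hμ m x
  have hs : ∀ y, ∑ x, (∑ m, μ m x) * W x y = ∑ m, ∑ x, μ m x * W x y := fun y => by
    rw [Finset.sum_comm]
    exact Finset.sum_congr rfl fun x _ => by rw [Finset.sum_mul]
  have e2 : ∑ m, ∑ y, negMulLog (∑ x, μ m x * W x y) ≤
      ∑ y, negMulLog (∑ x, (∑ m, μ m x) * W x y) + log M := by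
    have hm : ∑ y, ∑ m, ∑ x, μ m x * W x y = 1 := by
      simp only [← hs]
      rw [Finset.sum_comm, ← h1]
      exact Finset.sum_congr rfl fun x _ => by rw [← Finset.mul_sum, (hW x).2, mul_one]
    calc _ ≤ ∑ y, (negMulLog (∑ m, ∑ x, μ m x * W x y) + (∑ m, ∑ x, μ m x * W x y) * log M) := by
          rw [Finset.sum_comm]
          exact Finset.sum_le_sum fun y _ => sum_negMulLog_le _ fun m =>
            Finset.sum_nonneg fun x _ => mul_nonneg (hμ m x) ((hW x).1 y)
      _ = _ := by rw [Finset.sum_add_distrib, ← Finset.sum_mul, hm, one_mul]; simp only [hs]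
  linarith

theorem gh_iid {X Y : Type*} [Fintype X] [Fintype Y] {P : X → ℝ} (hP : IsDist P)
    {W : X → Y → ℝ} (hW : IsChannel W) (n : ℕ) :
    gh (memoryless W n) (iid P n) = n * gh W P := by
  classical
  unfold gh
  have h1 : ∀ ys : Fin n → Y, ∑ xs, iid P n xs * memoryless W n xs ys =
      iid (fun y => ∑ x, P x * W x y) n ys := fun ys => by
    unfold iid memoryless
    simp only [← Finset.prod_mul_distrib]
    rw [Fintype.prod_sum]
  simp only [h1]
  rw [sum_negMulLog_iid hP.2, sum_negMulLog_iid, mul_sub]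
  rw [Finset.sum_comm, ← hP.2]
  exact Finset.sum_congr rfl fun x _ => by rw [← Finset.mul_sum, (hW x).2, mul_one]

theorem converse {X Y Xh : Type*} [Fintype X] [Fintype Y] [Fintype Xh] [DecidableEq Y]
    [Nonempty Xh] {P : X → ℝ} (hP : IsDist P) (d : X → Xh → ℝ) {W : X → Y → ℝ}
    (hW : IsChannel W) {n : ℕ} (hn : 1 ≤ n) (C : Code X Y Xh n) :
    ∃ V : X → (Y → Xh) → ℝ, IsChannel V ∧
      dVW P d V W = C.expDist P d (memoryless W n) ∧
      phi P V W ≤ logb 2 (C.M : ℝ) / n := by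
  classical
  have hn0 : (0:ℝ) < n := by exact_mod_cast hn
  have hWn := memoryless_channel hW n
  have hiid : ∀ xs, 0 ≤ iid P n xs := fun xs => Finset.prod_nonneg fun t _ => hP.1 _
  have hμ : ∀ m xs, 0 ≤ iid P n xs * C.enc xs m := fun m xs =>
    mul_nonneg (hiid xs) ((C.enc_channel xs).1 m)
  have hμs : ∀ xs, ∑ m, iid P n xs * C.enc xs m = iid P n xs := fun xs => by
    rw [← Finset.mul_sum, (C.enc_channel xs).2, mul_one]
  obtain ⟨ν, a, b, c, g⟩ := Good.sum (d := d) hW Finset.univ fun m : Fin C.M =>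
    good_main (d := d) hW n (fun xs => iid P n xs * C.enc xs m) (hμ m) (C.dec m)
  have b' : ∀ x, ∑ u, ν u x = n * P x := fun x => by
    rw [b x]
    dsimp only
    rw [Finset.sum_comm]
    simp only [← Finset.sum_mul, hμs]
    have := sum_prod_mul_sum (fun _ : Fin n => P) (fun _ z => if z = x then (1:ℝ) else 0)
      fun _ => hP.2
    unfold iid
    rw [this]
    simp
  have ν0 : ∀ u x, P x = 0 → ν u x = 0 := fun u x h => by
    have h1 := b' x
    rw [h, mul_zero, Finset.sum_eq_zero_iff_of_nonneg fun u _ => a u x] at h1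
    exact h1 u (Finset.mem_univ u)
  obtain ⟨u₀⟩ : Nonempty (Y → Xh) := inferInstance
  let V : X → (Y → Xh) → ℝ := fun x u =>
    if P x = 0 then (if u = u₀ then 1 else 0) else ν u x / (n * P x)
  have hPV : ∀ x u, P x * V x u = (n:ℝ)⁻¹ * ν u x := fun x u => by
    by_cases h : P x = 0
    · simp [h, ν0 u x h]
    · simp only [V, h, if_false]; field_simp
  have hV : IsChannel V := fun x => by
    by_cases h : P x = 0
    · refine ⟨fun u => ?_, ?_⟩
      · simp only [V, h, if_true]; split_ifs <;> norm_num
      · simp [V, h]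
    · refine ⟨fun u => ?_, ?_⟩
      · simp only [V, h, if_false]; exact div_nonneg (a u x) (mul_nonneg hn0.le (hP.1 x))
      · simp only [V, h, if_false]
        rw [← Finset.sum_div, b' x, div_self (mul_ne_zero hn0.ne' h)]
  refine ⟨V, hV, ?_, ?_⟩
  · have e1 : dVW P d V W = (n:ℝ)⁻¹ * ∑ u, ∑ x, ∑ y, ν u x * W x y * d x (u y) := by
      unfold dVW
      simp only [hPV, Finset.mul_sum, mul_assoc]
    rw [e1, c]
    unfold Code.expDist dseq
    rw [Finset.sum_comm, Finset.mul_sum]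
    refine Finset.sum_congr rfl fun xs _ => ?_
    rw [Finset.sum_comm, Finset.mul_sum]
    refine Finset.sum_congr rfl fun ys _ => ?_
    rw [Finset.mul_sum]
    refine Finset.sum_congr rfl fun m _ => ?_
    field_simp
  · rw [phi_eq hV hW]
    simp only [hPV, gh_smul hW]
    rw [← Finset.mul_sum]
    have r := gh_rate hWn (fun m xs => iid P n xs * C.enc xs m) hμ (by
      simp only [hμs]
      exact sum_prod_eq_one (fun _ : Fin n => P) fun _ => hP.2)
    simp only [hμs] at r
    have r' : gh (memoryless W n) (iid P n) - ∑ m, gh (memoryless W n)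
      (fun xs => iid P n xs * C.enc xs m) ≤ log C.M := r
    rw [gh_iid hP hW] at r'
    have hl : 0 < log 2 := log_pos (by norm_num)
    rw [logb, div_right_comm]
    refine div_le_div_of_nonneg_right ?_ hl.le
    rw [le_div_iff₀ hn0, sub_mul, mul_right_comm, inv_mul_cancel₀ hn0.ne', one_mul]
    linarith

theorem memoryless_mem {X Y : Type*} [Fintype X] [Fintype Y] {P : X → ℝ} (hP : IsDist P)
    {e : X → Y → ℝ} {E : ℝ} {W : X → Y → ℝ} (hW : W ∈ W1 P e E) :
    (fun n => memoryless W n) ∈ AvgClass P e E := by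
  refine ⟨fun n => memoryless_channel hW.1 n, fun n hn => ?_⟩
  have hn0 : (0:ℝ) < n := by exact_mod_cast hn
  refine le_trans (le_of_eq ?_) hW.2
  unfold avgSideDist dseq eDist
  have h1 : ∀ xs : Fin n → X, ∑ ys, iid P n xs * memoryless W n xs ys *
      ((∑ t, e (xs t) (ys t)) / n) =
      (n:ℝ)⁻¹ * ((∏ t, P (xs t)) * ∑ t, ∑ y, W (xs t) y * e (xs t) y) := fun xs => by
    rw [← sum_prod_mul_sum (fun t => W (xs t)) (fun t => e (xs t)) fun t => (hW.1 _).2,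
      Finset.mul_sum, Finset.mul_sum]
    refine Finset.sum_congr rfl fun ys _ => ?_
    unfold iid memoryless
    field_simp
  rw [Finset.sum_congr rfl fun xs _ => h1 xs, ← Finset.mul_sum,
    sum_prod_mul_sum (fun _ : Fin n => P) (fun _ x => ∑ y, W x y * e x y) fun _ => hP.2]
  simp only [Finset.sum_const, Finset.card_univ, Fintype.card_fin, nsmul_eq_mul]
  rw [inv_mul_cancel_left₀ hn0.ne']
  simp only [Finset.mul_sum, mul_assoc]

theorem achievable_nonempty {X Y Xh : Type*} [Fintype X] [Fintype Y] [Fintype Xh] [Nonempty X]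
    (P : X → ℝ) (d : X → Xh → ℝ) (hdZ : ∀ x, ∃ xh, d x xh = 0)
    (WC : Set (ChannelSeq X Y)) (D : ℝ) (hD : 0 ≤ D) :
    Achievable P d WC D (logb 2 (Fintype.card X)) := by
  classical
  intro ε hε
  choose z hz using hdZ
  let eqv : ∀ n, (Fin n → X) ≃ Fin (Fintype.card (Fin n → X)) := fun n => Fintype.equivFin _
  refine ⟨1, fun n => ⟨Fintype.card (Fin n → X), Fintype.card_pos,
    fun xs m => if m = eqv n xs then 1 else 0, fun xs => ⟨fun m => ?_, by simp⟩,
    fun m _ t => z ((eqv n).symm m t)⟩, fun n hn => ⟨?_, fun Ws _ => ?_⟩⟩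
  · dsimp only; split_ifs <;> norm_num
  · have hn0 : (n:ℝ) ≠ 0 := by
      have : n ≠ 0 := by omega
      exact_mod_cast this
    simp only [Fintype.card_pi, Finset.prod_const, Finset.card_univ, Fintype.card_fin, Nat.cast_pow,
      logb_pow]
    rw [mul_div_cancel_left₀ _ hn0]
    linarith
  · refine le_trans (le_of_eq ?_) (add_nonneg hD hε.le)
    unfold Code.expDist
    refine Finset.sum_eq_zero fun xs _ => Finset.sum_eq_zero fun ys _ =>
      Finset.sum_eq_zero fun m _ => ?_
    by_cases h : m = eqv n xs
    · subst h; simp [dseq, hz]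
    · simp [h]

theorem RWZ_le {X Y Xh : Type*} [Fintype X] [Fintype Y] [Fintype Xh] [DecidableEq Y]
    [Nonempty Xh] {P : X → ℝ} (hP : IsDist P) {e : X → Y → ℝ} (d : X → Xh → ℝ) {D E R : ℝ}
    {W : X → Y → ℝ} (hW : W ∈ W1 P e E) (hR : Achievable P d (AvgClass P e E) D R) :
    RWZ P d D W ≤ R := by
  have key : ∀ k : ℕ, ∃ V : X → (Y → Xh) → ℝ, IsChannel V ∧ dVW P d V W ≤ D + 1 / ((k:ℝ) + 1) ∧
      phi P V W ≤ R + 1 / ((k:ℝ) + 1) := fun k => by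
    obtain ⟨n0, C, hC⟩ := hR (1 / ((k:ℝ) + 1)) (by positivity)
    obtain ⟨c1, c2⟩ := hC (max n0 1) (le_max_left _ _)
    obtain ⟨V, v1, v2, v3⟩ := converse hP d hW.1 (le_max_right n0 1) (C (max n0 1))
    exact ⟨V, v1, v2.trans_le (c2 _ (memoryless_mem hP hW)), v3.trans c1⟩
  choose V v1 v2 v3 using key
  obtain ⟨V', hV', s, hs, ht⟩ := isCompact_channels.tendsto_subseq v1
  have hε : ∀ c : ℝ, Filter.Tendsto (fun k => c + 1 / (((s k : ℕ) : ℝ) + 1)) Filter.atTop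
      (nhds c) := fun c => by
    have := (tendsto_one_div_add_atTop_nhds_zero_nat (𝕜 := ℝ)).comp hs.tendsto_atTop
    simpa using this.const_add c
  have hd' : dVW P d V' W ≤ D :=
    le_of_tendsto_of_tendsto' (((dVW_continuous P d W).tendsto V').comp ht) (hε D) fun k => v2 (s k)
  have hp' : phi P V' W ≤ R :=
    le_of_tendsto_of_tendsto' (((phi_continuous P W).tendsto V').comp ht) (hε R) fun k => v3 (s k)
  refine le_trans (csInf_le ?_ ⟨V', ⟨hV', hd'⟩, rfl⟩) hp'
  exact (isCompact_channels.bddBelow_image (phi_continuous P W).continuousOn).mono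
    (Set.image_mono fun V hV => hV.1)

end Aux

/-- The average distortion class rate-distortion function dominates the
worst-case Wyner–Ziv rate: `R_a(D|E) ≥ max_{W ∈ 𝒲₁(E)} R_WZ(D|W)`. -/
theorem Ra_ge_max_RWZ
    {X Y Xh : Type*} [Fintype X] [Fintype Y] [Fintype Xh] [DecidableEq Y]
    [Nonempty X] [Nonempty Y] [Nonempty Xh]
    (P : X → ℝ) (hP : IsDist P)
    (e : X → Y → ℝ) (he0 : ∀ x y, 0 ≤ e x y) (heZ : ∀ x, ∃ y, e x y = 0)
    (d : X → Xh → ℝ) (hd0 : ∀ x xh, 0 ≤ d x xh) (hdZ : ∀ x, ∃ xh, d x xh = 0)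
    (D E : ℝ) (hD : 0 ≤ D) (hE : 0 ≤ E) :
    sSup ((fun W => RWZ P d D W) '' W1 P e E) ≤ Ra P e d D E := by
  have hW1 : (W1 P e E).Nonempty := by
    classical
    choose z hz using heZ
    refine ⟨fun x y => if y = z x then 1 else 0, fun x => ⟨fun y => ?_, by simp⟩, ?_⟩
    · dsimp only; split_ifs <;> norm_num
    · refine le_trans (le_of_eq ?_) hE
      unfold eDist
      refine Finset.sum_eq_zero fun x _ => Finset.sum_eq_zero fun y _ => ?_
      by_cases h : y = z x
      · simp [h, hz]
      · simp [h]
  refine csSup_le (hW1.image _) ?_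
  rintro _ ⟨W, hW, rfl⟩
  exact le_csInf ⟨_, achievable_nonempty P d hdZ _ D hD⟩ fun R hR => RWZ_le hP d hW hR

end UWZ
end
end

section
/- If E ≥ E_* := min_{y ∈ 𝒴} ∑_{x ∈ 𝒳} P_X(x) e(x,y), then R_a(D|E) = R(D), where R(D) is the classical rate-distortion function of the source P_X (without side-information) for the distortion measure d. -/
open scoped BigOperators

noncomputable section

namespace UWZ

/-! ### Basic facts on finite distributions -/

lemma ind_pos {p : Prop} (h : p) : ind p = 1 := by simp [ind, h]

lemma ind_neg {p : Prop} (h : ¬ p) : ind p = 0 := by simp [ind, h]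

lemma ind_nonneg (p : Prop) : 0 ≤ ind p := by
  by_cases h : p
  · rw [ind_pos h]; norm_num
  · rw [ind_neg h]

lemma ind_add_not (p : Prop) : ind p + ind (¬ p) = 1 := by
  by_cases h : p
  · rw [ind_pos h, ind_neg (not_not.mpr h)]; norm_num
  · rw [ind_neg h, ind_pos h]; norm_num

lemma sum_prod_fun {A : Type*} [Fintype A] {n : ℕ} (f : Fin n → A → ℝ) :
    ∑ xs : Fin n → A, ∏ t, f t (xs t) = ∏ t, ∑ a, f t a := by
  rw [Finset.prod_univ_sum]
  simp [Fintype.piFinset_univ]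

lemma iid_nonneg {A : Type*} [Fintype A] {P : A → ℝ} (hP : IsDist P) (n : ℕ) (xs : Fin n → A) :
    0 ≤ iid P n xs := Finset.prod_nonneg fun t _ => hP.1 _

lemma iid_sum {A : Type*} [Fintype A] {P : A → ℝ} (hP : IsDist P) (n : ℕ) :
    ∑ xs, iid P n xs = 1 := by
  unfold iid
  rw [sum_prod_fun (fun _ a => P a)]
  simp [hP.2]

lemma iid_isDist {A : Type*} [Fintype A] {P : A → ℝ} (hP : IsDist P) (n : ℕ) :
    IsDist (iid P n) := ⟨iid_nonneg hP n, iid_sum hP n⟩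

lemma iid_marg {A : Type*} [Fintype A] {P : A → ℝ} (hP : IsDist P) (n : ℕ) (t : Fin n)
    (f : A → ℝ) : ∑ xs, iid P n xs * f (xs t) = ∑ a, P a * f a := by
  have h : ∀ xs : Fin n → A, iid P n xs * f (xs t)
      = ∏ s, (P (xs s) * if s = t then f (xs s) else 1) := by
    intro xs
    rw [Finset.prod_mul_distrib]
    simp [iid, Finset.prod_ite_eq']
  simp_rw [h]
  rw [sum_prod_fun (fun s a => P a * if s = t then f a else 1)]
  rw [Finset.prod_eq_single t]
  · simp
  · intro s _ hs
    simp [hs, hP.2]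
  · simp

lemma iid_pair {A : Type*} [Fintype A] {P : A → ℝ} (n : ℕ) (s t : Fin n)
    (hst : s ≠ t) (f : A → ℝ) (hf : ∑ a, P a * f a = 0) :
    ∑ xs, iid P n xs * (f (xs s) * f (xs t)) = 0 := by
  have h : ∀ xs : Fin n → A, iid P n xs * (f (xs s) * f (xs t))
      = ∏ u, (P (xs u) * ((if u = s then f (xs u) else 1) * if u = t then f (xs u) else 1)) := by
    intro xs
    rw [Finset.prod_mul_distrib, Finset.prod_mul_distrib]
    simp [iid, Finset.prod_ite_eq']
  simp_rw [h]
  rw [sum_prod_fun (fun u a => P a * ((if u = s then f a else 1) * if u = t then f a else 1))]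
  apply Finset.prod_eq_zero (Finset.mem_univ s)
  simpa [hst] using hf

lemma iid_second {A : Type*} [Fintype A] {P : A → ℝ} (hP : IsDist P) (n : ℕ)
    (f : A → ℝ) (hf : ∑ a, P a * f a = 0) :
    ∑ xs, iid P n xs * (∑ t, f (xs t)) ^ 2 = n * ∑ a, P a * f a ^ 2 := by
  have h : ∀ xs : Fin n → A, iid P n xs * (∑ t, f (xs t)) ^ 2
      = ∑ s, ∑ t, iid P n xs * (f (xs s) * f (xs t)) := by
    intro xs
    rw [sq, Finset.sum_mul_sum, Finset.mul_sum]
    simp_rw [Finset.mul_sum]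
  simp_rw [h]
  rw [Finset.sum_comm]
  have h2 : ∀ s : Fin n, ∑ xs : Fin n → A, ∑ t, iid P n xs * (f (xs s) * f (xs t))
      = ∑ a, P a * f a ^ 2 := by
    intro s
    rw [Finset.sum_comm, Finset.sum_eq_single s]
    · have := iid_marg hP n s (fun a => f a ^ 2)
      rw [← this]
      exact Finset.sum_congr rfl fun xs _ => by ring
    · intro t _ hts
      exact iid_pair n s t (Ne.symm hts) f hf
    · simp
  simp_rw [h2]
  simp

lemma iid_cheb {A : Type*} [Fintype A] {P : A → ℝ} (hP : IsDist P) (f : A → ℝ) :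
    ∃ V : ℝ, 0 ≤ V ∧ ∀ n : ℕ, 1 ≤ n → ∀ δ : ℝ, 0 < δ → ∀ μ : ℝ, ∑ a, P a * f a ≤ μ →
      ∑ xs, iid P n xs * ind (n * (μ + δ) < ∑ t, f (xs t)) ≤ V / (n * δ ^ 2) := by
  set ν := ∑ a, P a * f a with hν
  refine ⟨∑ a, P a * (f a - ν) ^ 2,
    Finset.sum_nonneg fun a _ => mul_nonneg (hP.1 a) (sq_nonneg _), ?_⟩
  intro n hn δ hδ μ hμ
  have hn' : (0:ℝ) < n := by exact_mod_cast hn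
  have h0 : ∑ a, P a * (f a - ν) = 0 := by
    simp_rw [mul_sub]
    rw [Finset.sum_sub_distrib, ← Finset.sum_mul, hP.2, ← hν]; ring
  have h2 := iid_second hP n (fun a => f a - ν) h0
  have h3 : ∀ xs : Fin n → A, ind (n * (μ + δ) < ∑ t, f (xs t))
      ≤ (∑ t, (f (xs t) - ν)) ^ 2 / (n * δ) ^ 2 := by
    intro xs
    by_cases h : n * (μ + δ) < ∑ t, f (xs t)
    · rw [ind_pos h, one_le_div (by positivity)]
      apply pow_le_pow_left₀ (by positivity)
      rw [Finset.sum_sub_distrib]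
      simp only [Finset.sum_const, Finset.card_univ, Fintype.card_fin, nsmul_eq_mul]
      nlinarith [mul_le_mul_of_nonneg_left hμ hn'.le]
    · rw [ind_neg h]; positivity
  calc _ ≤ ∑ xs, iid P n xs * ((∑ t, (f (xs t) - ν)) ^ 2 / (n * δ) ^ 2) :=
        Finset.sum_le_sum fun xs _ => mul_le_mul_of_nonneg_left (h3 xs) (iid_nonneg hP n xs)
    _ = (∑ xs, iid P n xs * (∑ t, (f (xs t) - ν)) ^ 2) / (n * δ) ^ 2 := by
        rw [Finset.sum_div]
        exact Finset.sum_congr rfl fun xs _ => by ring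
    _ = _ := by
        rw [h2]; field_simp

/-! ### Mutual information -/

/-- output marginal. -/
def outM {X Xh : Type*} [Fintype X] (P : X → ℝ) (Q : X → Xh → ℝ) (b : Xh) : ℝ :=
  ∑ x, P x * Q x b

/-- likelihood ratio. -/
def lr {X Xh : Type*} [Fintype X] (P : X → ℝ) (Q : X → Xh → ℝ) (x : X) (b : Xh) : ℝ :=
  Q x b / outM P Q b

section MI
variable {X Xh : Type*} [Fintype X] [Fintype Xh] {P : X → ℝ} {Q : X → Xh → ℝ}

lemma outM_isDist (hP : IsDist P) (hQ : IsChannel Q) : IsDist (outM P Q) := by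
  refine ⟨fun b => Finset.sum_nonneg fun x _ => mul_nonneg (hP.1 x) ((hQ x).1 b), ?_⟩
  unfold outM
  rw [Finset.sum_comm]
  simp_rw [← Finset.mul_sum, (hQ _).2, mul_one]
  exact hP.2

lemma joint_isDist (hP : IsDist P) (hQ : IsChannel Q) :
    IsDist (fun p : X × Xh => P p.1 * Q p.1 p.2) := by
  refine ⟨fun p => mul_nonneg (hP.1 _) ((hQ _).1 _), ?_⟩
  rw [Fintype.sum_prod_type]
  simp_rw [← Finset.mul_sum, (hQ _).2, mul_one]
  exact hP.2

lemma le_outM (hP : IsDist P) (hQ : IsChannel Q) (x : X) (b : Xh) :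
    P x * Q x b ≤ outM P Q b :=
  Finset.single_le_sum (f := fun x => P x * Q x b)
    (fun x _ => mul_nonneg (hP.1 x) ((hQ x).1 b)) (Finset.mem_univ x)

lemma lr_nonneg (hP : IsDist P) (hQ : IsChannel Q) (x : X) (b : Xh) : 0 ≤ lr P Q x b :=
  div_nonneg ((hQ x).1 b) ((outM_isDist hP hQ).1 b)

lemma lr_mul (hP : IsDist P) (hQ : IsChannel Q) (x : X) (b : Xh) (hx : P x ≠ 0) :
    lr P Q x b * outM P Q b = Q x b := by
  unfold lr
  by_cases h : outM P Q b = 0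
  · have h1 := le_outM hP hQ x b
    rw [h] at h1
    have h2 : P x * Q x b = 0 := le_antisymm h1 (mul_nonneg (hP.1 x) ((hQ x).1 b))
    rcases mul_eq_zero.mp h2 with h3 | h3
    · exact absurd h3 hx
    · rw [h3, h]; simp
  · field_simp

lemma mutInf_eq (hP : IsDist P) (hQ : IsChannel Q) :
    mutInf (fun p : X × Xh => P p.1 * Q p.1 p.2)
      = ∑ x, ∑ b, P x * Q x b * Real.logb 2 (lr P Q x b) := by
  have h : ∀ x b, P x * Q x b * Real.logb 2 (lr P Q x b)
      = P x * Q x b * Real.logb 2 (P x * Q x b) - P x * Q x b * Real.logb 2 (P x)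
        - P x * Q x b * Real.logb 2 (outM P Q b) := by
    intro x b
    by_cases h0 : P x * Q x b = 0
    · rw [h0]; ring
    · have h1 : P x ≠ 0 := left_ne_zero_of_mul h0
      have h2 : Q x b ≠ 0 := right_ne_zero_of_mul h0
      have h3 : outM P Q b ≠ 0 := by
        have := le_outM hP hQ x b
        have h4 : 0 < P x * Q x b :=
          lt_of_le_of_ne (mul_nonneg (hP.1 x) ((hQ x).1 b)) (Ne.symm h0)
        linarith
      unfold lr
      rw [Real.logb_div h2 h3, Real.logb_mul h1 h2]; ring
  simp_rw [h, Finset.sum_sub_distrib]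
  unfold mutInf ent
  rw [Fintype.sum_prod_type]
  have e1 : ∀ x, ∑ b, P x * Q x b = P x := fun x => by rw [← Finset.mul_sum, (hQ x).2, mul_one]
  have e2 : ∑ x, ∑ b, P x * Q x b * Real.logb 2 (P x) = ∑ x, P x * Real.logb 2 (P x) := by
    refine Finset.sum_congr rfl fun x _ => ?_
    rw [← Finset.sum_mul, e1]
  have e3 : ∑ x, ∑ b, P x * Q x b * Real.logb 2 (outM P Q b)
      = ∑ b, outM P Q b * Real.logb 2 (outM P Q b) := by
    rw [Finset.sum_comm]
    refine Finset.sum_congr rfl fun b _ => ?_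
    rw [← Finset.sum_mul]; rfl
  rw [e2, e3]
  simp only [e1]
  unfold outM
  ring

lemma mutInf_nonneg (hP : IsDist P) (hQ : IsChannel Q) :
    0 ≤ mutInf (fun p : X × Xh => P p.1 * Q p.1 p.2) := by
  rw [mutInf_eq hP hQ]
  have h : ∀ x b, (P x * Q x b - P x * outM P Q b) / Real.log 2
      ≤ P x * Q x b * Real.logb 2 (lr P Q x b) := by
    intro x b
    have hl : 0 < Real.log 2 := Real.log_pos (by norm_num)
    have hr := (outM_isDist hP hQ).1 b
    by_cases h0 : P x * Q x b = 0
    · rw [h0]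
      have : 0 ≤ P x * outM P Q b := mul_nonneg (hP.1 x) hr
      rw [zero_mul]
      apply div_nonpos_of_nonpos_of_nonneg _ hl.le
      linarith
    · have h1 : P x ≠ 0 := left_ne_zero_of_mul h0
      have h2 : Q x b ≠ 0 := right_ne_zero_of_mul h0
      have hlm := lr_mul hP hQ x b h1
      have hg : 0 < lr P Q x b := by
        apply lt_of_le_of_ne (lr_nonneg hP hQ x b)
        intro hh
        rw [← hh, zero_mul] at hlm
        exact h2 hlm.symm
      have := Real.one_sub_inv_le_log_of_pos hg
      unfold Real.logb
      rw [← mul_div_assoc]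
      apply div_le_div_of_nonneg_right _ hl.le
      have h3 : P x * Q x b - P x * outM P Q b = P x * Q x b * (1 - (lr P Q x b)⁻¹) := by
        rw [← hlm]; field_simp
      rw [h3]
      exact mul_le_mul_of_nonneg_left this (mul_nonneg (hP.1 x) ((hQ x).1 b))
  refine le_trans (le_of_eq ?_) (Finset.sum_le_sum fun x _ => Finset.sum_le_sum fun b _ => h x b)
  simp_rw [← Finset.sum_div, Finset.sum_sub_distrib, ← Finset.mul_sum, (hQ _).2,
    (outM_isDist hP hQ).2]
  simp

end MI

/-! ### Achievability -/

lemma cover_one {U : Type*} [Fintype U] {R : U → ℝ} (hR : IsDist R) (q : U → ℝ)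
    (hq : IsDist q) (S : U → Prop) (K : ℝ) (hK : 0 < K) (hS : ∀ u, S u → q u ≤ K * R u) (M : ℕ) :
    ∑ c : Fin M → U, iid R M c * ind (∀ m, ¬ S (c m))
      ≤ ∑ u, q u * ind (¬ S u) + Real.exp (-(M / K)) := by
  set b := ∑ u, q u * ind (S u) with hb
  have hb0 : 0 ≤ b := Finset.sum_nonneg fun u _ => mul_nonneg (hq.1 u) (ind_nonneg _)
  have hbn : ∑ u, q u * ind (¬ S u) = 1 - b := by
    rw [hb, ← hq.2, ← Finset.sum_sub_distrib]
    refine Finset.sum_congr rfl fun u _ => ?_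
    have := ind_add_not (S u)
    linear_combination q u * this
  have hb1 : b ≤ 1 := by
    have : 0 ≤ ∑ u, q u * ind (¬ S u) :=
      Finset.sum_nonneg fun u _ => mul_nonneg (hq.1 u) (ind_nonneg _)
    linarith
  have h1 : ∀ c : Fin M → U, iid R M c * ind (∀ m, ¬ S (c m))
      = ∏ m, (R (c m) * ind (¬ S (c m))) := by
    intro c
    rw [Finset.prod_mul_distrib]
    unfold iid
    congr 1
    by_cases h : ∀ m, ¬ S (c m)
    · rw [ind_pos h]
      exact (Finset.prod_eq_one fun m _ => ind_pos (h m)).symm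
    · rw [ind_neg h]
      push Not at h
      obtain ⟨m, hm⟩ := h
      exact (Finset.prod_eq_zero (Finset.mem_univ m) (ind_neg (not_not.mpr hm))).symm
  simp_rw [h1]
  rw [sum_prod_fun (fun _ u => R u * ind (¬ S u))]
  rw [Finset.prod_const, Finset.card_univ, Fintype.card_fin]
  set a := ∑ u, R u * ind (¬ S u) with ha
  have ha0 : 0 ≤ a := Finset.sum_nonneg fun u _ => mul_nonneg (hR.1 u) (ind_nonneg _)
  have hab : b / K ≤ 1 - a := by
    have e : 1 - a = ∑ u, R u * ind (S u) := by
      rw [ha, ← hR.2, ← Finset.sum_sub_distrib]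
      refine Finset.sum_congr rfl fun u _ => ?_
      have := ind_add_not (S u)
      linear_combination (-R u) * this
    rw [e, hb, div_le_iff₀ hK, Finset.sum_mul]
    refine Finset.sum_le_sum fun u _ => ?_
    by_cases h : S u
    · rw [ind_pos h]; have := hS u h; linarith
    · rw [ind_neg h]; simp
  have hae : a ≤ Real.exp (-(b / K)) := by
    have := Real.add_one_le_exp (-(b / K))
    linarith
  calc a ^ M ≤ Real.exp (-(b / K)) ^ M := pow_le_pow_left₀ ha0 hae M
    _ = Real.exp (b * (-(M / K)) + (1 - b) * 0) := by
        rw [← Real.exp_nat_mul]; congr 1; ring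
    _ ≤ b * Real.exp (-(M / K)) + (1 - b) * Real.exp 0 := by
        have := convexOn_exp.2 (Set.mem_univ (-(M / K))) (Set.mem_univ (0:ℝ)) hb0
          (sub_nonneg.mpr hb1) (by ring)
        simpa [smul_eq_mul] using this
    _ ≤ _ := by
        rw [hbn, Real.exp_zero]
        nlinarith [Real.exp_pos (-(M / K))]

section Ach
variable {X Xh : Type*} [Fintype X] [Fintype Xh] {P : X → ℝ} {Q : X → Xh → ℝ}

lemma memoryless_isDist (hQ : IsChannel Q) (n : ℕ) (xs : Fin n → X) :
    IsDist (memoryless Q n xs) := by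
  refine ⟨fun ys => Finset.prod_nonneg fun t _ => (hQ _).1 _, ?_⟩
  unfold memoryless
  rw [sum_prod_fun (fun t b => Q (xs t) b)]
  exact Finset.prod_eq_one fun t _ => (hQ _).2

lemma sum_joint (n : ℕ) (F : (Fin n → X) → (Fin n → Xh) → ℝ) :
    ∑ xs, ∑ ys, iid P n xs * memoryless Q n xs ys * F xs ys
      = ∑ zs : Fin n → X × Xh, iid (fun p : X × Xh => P p.1 * Q p.1 p.2) n zs
          * F (fun t => (zs t).1) (fun t => (zs t).2) := by
  rw [← Fintype.sum_prod_type'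
    (f := fun xs ys => iid P n xs * memoryless Q n xs ys * F xs ys)]
  symm
  refine Fintype.sum_equiv (Equiv.arrowProdEquivProdArrow (Fin n) (fun _ => X) (fun _ => Xh))
    _ _ fun zs => ?_
  simp [iid, memoryless, Equiv.arrowProdEquivProdArrow, Finset.prod_mul_distrib]

lemma memoryless_le (hP : IsDist P) (hQ : IsChannel Q) (n : ℕ) (xs : Fin n → X)
    (ys : Fin n → Xh) (hxs : iid P n xs ≠ 0) (s : ℝ)
    (h : ∑ t, Real.logb 2 (lr P Q (xs t) (ys t)) ≤ s) :
    memoryless Q n xs ys ≤ (2:ℝ) ^ s * iid (outM P Q) n ys := by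
  have hx : ∀ t, P (xs t) ≠ 0 := fun t => Finset.prod_ne_zero_iff.mp hxs t (Finset.mem_univ t)
  have e : memoryless Q n xs ys
      = (∏ t, lr P Q (xs t) (ys t)) * iid (outM P Q) n ys := by
    unfold memoryless iid
    rw [← Finset.prod_mul_distrib]
    exact Finset.prod_congr rfl fun t _ => (lr_mul hP hQ _ _ (hx t)).symm
  rw [e]
  refine mul_le_mul_of_nonneg_right ?_ (iid_nonneg (outM_isDist hP hQ) n ys)
  by_cases h0 : ∏ t, lr P Q (xs t) (ys t) = 0
  · rw [h0]; positivity
  · have h1 : ∀ t ∈ Finset.univ, lr P Q (xs t) (ys t) ≠ 0 := Finset.prod_ne_zero_iff.mp h0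
    have hpos : 0 < ∏ t, lr P Q (xs t) (ys t) :=
      lt_of_le_of_ne (Finset.prod_nonneg fun t _ => lr_nonneg hP hQ _ _) (Ne.symm h0)
    rw [← Real.logb_le_iff_le_rpow (by norm_num) hpos]
    rw [Real.logb_prod _ _ h1]
    exact h

lemma exists_book (hP : IsDist P) (hQ : IsChannel Q) (d : X → Xh → ℝ)
    (D : ℝ) (hQD : ∑ x, ∑ b, P x * Q x b * d x b ≤ D) :
    ∃ V : ℝ, 0 ≤ V ∧ ∀ n : ℕ, 1 ≤ n → ∀ δ : ℝ, 0 < δ → ∀ M : ℕ,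
      ∃ c : Fin M → Fin n → Xh,
        ∑ xs, iid P n xs * ind (∀ m, ¬ dseq d n xs (c m) ≤ D + δ)
          ≤ V / (n * δ ^ 2) + Real.exp (-(M / (2:ℝ) ^
            (n * (mutInf (fun p : X × Xh => P p.1 * Q p.1 p.2) + δ)))) := by
  set J : X × Xh → ℝ := fun p => P p.1 * Q p.1 p.2 with hJ
  have hJd : IsDist J := joint_isDist hP hQ
  obtain ⟨V1, hV1, h1⟩ := iid_cheb hJd (fun p => d p.1 p.2)
  obtain ⟨V2, hV2, h2⟩ := iid_cheb hJd (fun p => Real.logb 2 (lr P Q p.1 p.2))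
  refine ⟨V1 + V2, by positivity, ?_⟩
  intro n hn δ hδ M
  have hn' : (0:ℝ) < n := by exact_mod_cast hn
  set I := mutInf J with hI
  have h1' := h1 n hn δ hδ D (by rw [Fintype.sum_prod_type]; exact hQD)
  have h2' := h2 n hn δ hδ I (by
    rw [Fintype.sum_prod_type, hI, hJ, mutInf_eq hP hQ])
  set K : ℝ := (2:ℝ) ^ (n * (I + δ)) with hK
  have hK0 : 0 < K := by positivity
  let S : (Fin n → X) → (Fin n → Xh) → Prop := fun xs ys =>
    ∑ t, d (xs t) (ys t) ≤ n * (D + δ) ∧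
      ∑ t, Real.logb 2 (lr P Q (xs t) (ys t)) ≤ n * (I + δ)
  have hRd : IsDist (iid (outM P Q) n) := iid_isDist (outM_isDist hP hQ) n
  have hcov : ∀ xs, iid P n xs * ∑ c : Fin M → Fin n → Xh,
      iid (iid (outM P Q) n) M c * ind (∀ m, ¬ S xs (c m))
      ≤ iid P n xs * (∑ ys, memoryless Q n xs ys * ind (¬ S xs ys) + Real.exp (-(M / K))) := by
    intro xs
    by_cases h0 : iid P n xs = 0
    · rw [h0]; simp
    · refine mul_le_mul_of_nonneg_left ?_ (iid_nonneg hP n xs)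
      refine cover_one hRd _ (memoryless_isDist hQ n xs) (S xs) K hK0 ?_ M
      intro ys hys
      exact memoryless_le hP hQ n xs ys h0 _ hys.2
  have hbad : ∑ xs, ∑ ys, iid P n xs * memoryless Q n xs ys * ind (¬ S xs ys)
      ≤ (V1 + V2) / (n * δ ^ 2) := by
    rw [sum_joint n (fun xs ys => ind (¬ S xs ys)), add_div]
    refine le_trans ?_ (add_le_add h1' h2')
    rw [← Finset.sum_add_distrib]
    refine Finset.sum_le_sum fun zs _ => ?_
    rw [← mul_add]
    refine mul_le_mul_of_nonneg_left ?_ (iid_nonneg hJd n zs)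
    by_cases hs : S (fun t => (zs t).1) (fun t => (zs t).2)
    · rw [ind_neg (not_not.mpr hs)]
      exact add_nonneg (ind_nonneg _) (ind_nonneg _)
    · rw [ind_pos hs]
      rcases not_and_or.mp hs with h | h
      · rw [ind_pos (not_le.mp h)]
        have := ind_nonneg (↑n * (I + δ) < ∑ t, Real.logb 2 (lr P Q (zs t).1 (zs t).2))
        linarith
      · rw [ind_pos (not_le.mp h)]
        have := ind_nonneg (↑n * (D + δ) < ∑ t, d (zs t).1 (zs t).2)
        linarith
  have hR2 : IsDist (iid (iid (outM P Q) n) M) := iid_isDist hRd M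
  set B := (V1 + V2) / (n * δ ^ 2) + Real.exp (-(M / K)) with hB
  let F : (Fin M → Fin n → Xh) → ℝ := fun c => ∑ xs, iid P n xs * ind (∀ m, ¬ S xs (c m))
  have hF : ∑ c, iid (iid (outM P Q) n) M c * F c ≤ B := by
    have e : ∑ c, iid (iid (outM P Q) n) M c * F c
        = ∑ xs, iid P n xs * ∑ c : Fin M → Fin n → Xh,
            iid (iid (outM P Q) n) M c * ind (∀ m, ¬ S xs (c m)) := by
      simp_rw [F, Finset.mul_sum]
      rw [Finset.sum_comm]
      exact Finset.sum_congr rfl fun xs _ => Finset.sum_congr rfl fun c _ => by ring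
    rw [e]
    refine le_trans (Finset.sum_le_sum fun xs _ => hcov xs) ?_
    simp_rw [mul_add, Finset.sum_add_distrib]
    rw [← Finset.sum_mul, iid_sum hP, one_mul]
    refine add_le_add (le_trans (le_of_eq ?_) hbad) le_rfl
    refine Finset.sum_congr rfl fun xs _ => ?_
    rw [Finset.mul_sum]
    exact Finset.sum_congr rfl fun c _ => by ring
  obtain ⟨c, hc⟩ : ∃ c, F c ≤ B := by
    by_contra hcon
    push Not at hcon
    have h3 : ∑ c, iid (iid (outM P Q) n) M c * (F c - B) ≤ 0 := by
      simp_rw [mul_sub]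
      rw [Finset.sum_sub_distrib, ← Finset.sum_mul, hR2.2]
      linarith
    have h4 : ∀ c ∈ Finset.univ, 0 ≤ iid (iid (outM P Q) n) M c * (F c - B) := fun c _ =>
      mul_nonneg (hR2.1 c) (sub_nonneg.mpr (hcon c).le)
    have h5 := (Finset.sum_eq_zero_iff_of_nonneg h4).mp (le_antisymm h3 (Finset.sum_nonneg h4))
    have h6 : ∑ c, iid (iid (outM P Q) n) M c = 0 := by
      refine Finset.sum_eq_zero fun c hc => ?_
      rcases mul_eq_zero.mp (h5 c hc) with h | h
      · exact h
      · have := hcon c; linarith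
    rw [hR2.2] at h6
    exact one_ne_zero h6
  refine ⟨c, le_trans (Finset.sum_le_sum fun xs _ => ?_) hc⟩
  refine mul_le_mul_of_nonneg_left ?_ (iid_nonneg hP n xs)
  by_cases h : ∀ m, ¬ dseq d n xs (c m) ≤ D + δ
  · rw [ind_pos h, ind_pos]
    intro m hm
    apply h m
    unfold dseq
    rw [div_le_iff₀ hn']
    have := hm.1
    linarith
  · rw [ind_neg h]; exact ind_nonneg _

end Ach

lemma expDist_det {X Y Xh : Type*} [Fintype X] [Fintype Y] [Fintype Xh]
    {n M : ℕ} (P : X → ℝ) (d : X → Xh → ℝ) (C : Code X Y Xh n) (hM : C.M = M)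
    (Wn : (Fin n → X) → (Fin n → Y) → ℝ) (hW : IsChannel Wn) (g : (Fin n → X) → Fin C.M)
    (c : Fin C.M → Fin n → Xh) (h1 : ∀ xs m, C.enc xs m = if m = g xs then 1 else 0)
    (h2 : ∀ m ys, C.dec m ys = c m) :
    C.expDist P d Wn = ∑ xs, iid P n xs * dseq d n xs (c (g xs)) := by
  unfold Code.expDist
  refine Finset.sum_congr rfl fun xs _ => ?_
  have : ∀ ys, ∑ m, iid P n xs * Wn xs ys * C.enc xs m * dseq d n xs (C.dec m ys)
      = Wn xs ys * (iid P n xs * dseq d n xs (c (g xs))) := by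
    intro ys
    simp only [h1, h2]
    rw [Finset.sum_eq_single (g xs)]
    · simp; ring
    · intro m _ hm; simp [hm]
    · simp
  simp_rw [this]
  rw [← Finset.sum_mul, (hW xs).2, one_mul]

lemma achievable_of_channel {X Y Xh : Type*} [Fintype X] [Fintype Y] [Fintype Xh] [Nonempty Xh]
    {P : X → ℝ} (hP : IsDist P) (e : X → Y → ℝ) (d : X → Xh → ℝ) (hd0 : ∀ x b, 0 ≤ d x b)
    (D E : ℝ) (hD : 0 ≤ D) {Q : X → Xh → ℝ} (hQ : IsChannel Q)
    (hQD : ∑ x, ∑ b, P x * Q x b * d x b ≤ D) :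
    Achievable P d (AvgClass P e E) D (mutInf fun p : X × Xh => P p.1 * Q p.1 p.2) := by
  classical
  intro ε hε
  set I := mutInf fun p : X × Xh => P p.1 * Q p.1 p.2 with hI
  have hI0 : 0 ≤ I := mutInf_nonneg hP hQ
  obtain ⟨V, hV, hbook⟩ := exists_book hP hQ d D hQD
  set δ := ε / 3 with hδ
  have hδ0 : 0 < δ := by positivity
  let Mn : ℕ → ℕ := fun n => ⌈(2:ℝ) ^ (n * (I + 2 * δ))⌉₊
  have hMpos : ∀ n, 0 < Mn n := fun n => Nat.ceil_pos.mpr (by positivity)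
  set dm := ∑ x, ∑ b, d x b with hdm
  have hdm0 : 0 ≤ dm := Finset.sum_nonneg fun x _ => Finset.sum_nonneg fun b _ => hd0 x b
  have hdle : ∀ x b, d x b ≤ dm := by
    intro x b
    refine le_trans (Finset.single_le_sum (f := fun b => d x b) (fun b _ => hd0 x b)
      (Finset.mem_univ b)) ?_
    exact Finset.single_le_sum (f := fun x => ∑ b, d x b)
      (fun x _ => Finset.sum_nonneg fun b _ => hd0 x b) (Finset.mem_univ x)
  -- the code at each blocklength
  have hcode : ∀ n : ℕ, ∃ C : Code X Y Xh n, 1 ≤ n → C.M = Mn n ∧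
      ∀ Wn : (Fin n → X) → (Fin n → Y) → ℝ, IsChannel Wn → C.expDist P d Wn
        ≤ D + δ + dm * (V / (n * δ ^ 2) + Real.exp (-((2:ℝ) ^ (n * δ)))) := by
    intro n
    by_cases hn : 1 ≤ n
    swap
    · refine ⟨⟨1, one_pos, fun _ _ => 1, fun _ => ⟨fun _ => zero_le_one, by simp⟩,
        fun _ _ _ => Classical.arbitrary Xh⟩, fun h => absurd h hn⟩
    have hn' : (0:ℝ) < n := by exact_mod_cast hn
    obtain ⟨c, hc⟩ := hbook n hn δ hδ0 (Mn n)
    have hg : ∀ xs : Fin n → X, ∃ m : Fin (Mn n),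
        (∃ m', dseq d n xs (c m') ≤ D + δ) → dseq d n xs (c m) ≤ D + δ := by
      intro xs
      by_cases h : ∃ m', dseq d n xs (c m') ≤ D + δ
      · obtain ⟨m, hm⟩ := h
        exact ⟨m, fun _ => hm⟩
      · exact ⟨⟨0, hMpos n⟩, fun h' => absurd h' h⟩
    choose g hg using hg
    refine ⟨⟨Mn n, hMpos n, fun xs m => if m = g xs then 1 else 0, fun xs => ⟨fun m => ?_, ?_⟩,
      fun m _ => c m⟩, fun _ => ⟨rfl, fun Wn hWn => ?_⟩⟩
    · dsimp only; split_ifs <;> norm_num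
    · simp
    rw [expDist_det P d _ rfl Wn hWn g c (fun _ _ => rfl) (fun _ _ => rfl)]
    have hpt : ∀ xs, iid P n xs * dseq d n xs (c (g xs))
        ≤ iid P n xs * (D + δ) + dm *
          (iid P n xs * ind (∀ m, ¬ dseq d n xs (c m) ≤ D + δ)) := by
      intro xs
      have : dseq d n xs (c (g xs))
          ≤ (D + δ) + dm * ind (∀ m, ¬ dseq d n xs (c m) ≤ D + δ) := by
        by_cases h : ∀ m, ¬ dseq d n xs (c m) ≤ D + δ
        · rw [ind_pos h]
          have : dseq d n xs (c (g xs)) ≤ dm := by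
            unfold dseq
            rw [div_le_iff₀ hn']
            refine le_trans (Finset.sum_le_sum fun t _ => hdle _ _) ?_
            simp [mul_comm]
          linarith
        · rw [ind_neg h]
          push Not at h
          have := hg xs h
          linarith
      have h2 := mul_le_mul_of_nonneg_left this (iid_nonneg hP n xs)
      linarith
    refine le_trans (Finset.sum_le_sum fun xs _ => hpt xs) ?_
    rw [Finset.sum_add_distrib, ← Finset.sum_mul, iid_sum hP, one_mul, ← Finset.mul_sum]
    have hexp : Real.exp (-((Mn n : ℝ) / (2:ℝ) ^ (n * (I + δ))))
        ≤ Real.exp (-((2:ℝ) ^ (n * δ))) := by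
      rw [Real.exp_le_exp, neg_le_neg_iff, le_div_iff₀ (by positivity),
        ← Real.rpow_add (by norm_num)]
      refine le_trans (le_of_eq ?_) (Nat.le_ceil _)
      congr 1; ring
    have := mul_le_mul_of_nonneg_left (le_trans hc (add_le_add le_rfl hexp)) hdm0
    linarith
  choose C hC using hcode
  -- limits
  have hlim : Filter.Tendsto (fun n : ℕ => dm * (V / (n * δ ^ 2) + Real.exp (-((2:ℝ) ^ (n * δ)))))
      Filter.atTop (nhds (dm * (0 + 0))) := by
    refine Filter.Tendsto.const_mul _ (Filter.Tendsto.add ?_ ?_)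
    · refine Filter.Tendsto.div_atTop tendsto_const_nhds ?_
      exact Filter.Tendsto.atTop_mul_const (by positivity) tendsto_natCast_atTop_atTop
    · refine Real.tendsto_exp_neg_atTop_nhds_zero.comp ?_
      refine (tendsto_rpow_atTop_of_base_gt_one 2 (by norm_num)).comp ?_
      exact Filter.Tendsto.atTop_mul_const (by positivity) tendsto_natCast_atTop_atTop
  rw [add_zero, mul_zero] at hlim
  have hev1 := hlim.eventually (gt_mem_nhds hδ0)
  have hev2 := (tendsto_one_div_atTop_nhds_zero_nat (𝕜 := ℝ)).eventually (gt_mem_nhds hδ0)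
  obtain ⟨n0, hn0⟩ := Filter.eventually_atTop.mp
    ((hev1.and hev2).and (Filter.eventually_ge_atTop 1))
  refine ⟨n0, C, fun n hn => ?_⟩
  obtain ⟨⟨ha, hb⟩, hn1⟩ := hn0 n hn
  obtain ⟨hM, hdist⟩ := hC n hn1
  have hn' : (0:ℝ) < n := by exact_mod_cast hn1
  constructor
  · rw [hM]
    have h1 : (1:ℝ) ≤ (2:ℝ) ^ (n * (I + 2 * δ)) :=
      Real.one_le_rpow (by norm_num) (by positivity)
    have h2 : (Mn n : ℝ) ≤ (2:ℝ) ^ (n * (I + 2 * δ) + 1) := by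
      rw [Real.rpow_add (by norm_num), Real.rpow_one]
      have := Nat.ceil_lt_add_one (a := (2:ℝ) ^ (n * (I + 2 * δ))) (by positivity)
      simp only [Mn]
      linarith
    have h3 : Real.logb 2 (Mn n : ℝ) ≤ n * (I + 2 * δ) + 1 := by
      rw [Real.logb_le_iff_le_rpow (by norm_num) (by exact_mod_cast hMpos n)]
      exact h2
    rw [div_le_iff₀ hn']
    rw [div_lt_iff₀ hn'] at hb
    have : ε = 3 * δ := by rw [hδ]; ring
    rw [this]
    nlinarith
  · intro Wseq hW
    have h1 := hdist (Wseq n) (hW.1 n)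
    have : ε = 3 * δ := by rw [hδ]; ring
    linarith

/-! ### Converse -/

section Conv
variable {X Y Xh : Type*} [Fintype X] [Fintype Y] [Fintype Xh] [Nonempty Xh]

lemma single_letter {P : X → ℝ} (hP : IsDist P) {n M : ℕ} (hn : 1 ≤ n)
    (enc : (Fin n → X) → Fin M → ℝ) (henc : IsChannel enc) (c : Fin M → Fin n → Xh) :
    ∃ Q : X → Xh → ℝ, IsChannel Q ∧ ∀ h : X → Xh → ℝ,
      ∑ x, ∑ b, P x * Q x b * h x b
        = (∑ xs, ∑ m, iid P n xs * enc xs m * ∑ t, h (xs t) (c m t)) / n := by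
  classical
  have hn' : (0:ℝ) < n := by exact_mod_cast hn
  let J : X → Xh → ℝ := fun x b =>
    (∑ xs, ∑ m, iid P n xs * enc xs m * ∑ t, if xs t = x ∧ c m t = b then 1 else 0) / n
  have hJ : ∀ h : X → Xh → ℝ, ∑ x, ∑ b, J x b * h x b
      = (∑ xs, ∑ m, iid P n xs * enc xs m * ∑ t, h (xs t) (c m t)) / n := by
    intro h
    have h1 : ∀ x b, J x b * h x b = (∑ xs, ∑ m, ∑ t, iid P n xs * enc xs m *
        (if xs t = x ∧ c m t = b then h x b else 0)) / n := by
      intro x b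
      simp only [J]
      rw [div_mul_eq_mul_div]
      congr 1
      simp_rw [Finset.mul_sum, Finset.sum_mul]
      refine Finset.sum_congr rfl fun xs _ => Finset.sum_congr rfl fun m _ =>
        Finset.sum_congr rfl fun t _ => ?_
      split_ifs <;> ring
    simp_rw [h1, ← Finset.sum_div]
    congr 1
    rw [← Fintype.sum_prod_type' (f := fun x b => ∑ xs, ∑ m, ∑ t, iid P n xs * enc xs m *
        (if xs t = x ∧ c m t = b then h x b else 0))]
    rw [Finset.sum_comm]
    refine Finset.sum_congr rfl fun xs _ => ?_
    rw [Finset.sum_comm]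
    refine Finset.sum_congr rfl fun m _ => ?_
    rw [Finset.sum_comm, Finset.mul_sum]
    refine Finset.sum_congr rfl fun t _ => ?_
    rw [← Finset.mul_sum]
    congr 1
    rw [Finset.sum_eq_single (xs t, c m t)]
    · simp
    · rintro ⟨x, b⟩ _ hne
      rw [if_neg]
      rintro ⟨rfl, rfl⟩
      exact hne rfl
    · simp
  have hJ0 : ∀ x b, 0 ≤ J x b := by
    intro x b
    refine div_nonneg (Finset.sum_nonneg fun xs _ => Finset.sum_nonneg fun m _ =>
      mul_nonneg (mul_nonneg (iid_nonneg hP n xs) ((henc xs).1 m)) 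
        (Finset.sum_nonneg fun t _ => ?_)) hn'.le
    split_ifs <;> norm_num
  have hJm : ∀ x, ∑ b, J x b = P x := by
    intro x
    have h1 := hJ (fun x' _ => if x' = x then 1 else 0)
    have h2 : ∑ x', ∑ b, J x' b * (if x' = x then (1:ℝ) else 0) = ∑ b, J x b := by
      rw [Finset.sum_eq_single x]
      · simp
      · intro x' _ hx'; simp [hx']
      · simp
    rw [h2] at h1
    rw [h1, div_eq_iff hn'.ne']
    have h3 : ∀ xs : Fin n → X, ∑ m, iid P n xs * enc xs m * ∑ t, (if xs t = x then (1:ℝ) else 0)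
        = ∑ t, iid P n xs * (if xs t = x then (1:ℝ) else 0) := by
      intro xs
      rw [← Finset.sum_mul, ← Finset.mul_sum, (henc xs).2, mul_one, Finset.mul_sum]
    simp_rw [h3]
    rw [Finset.sum_comm]
    simp_rw [fun t => iid_marg hP n t (fun a => if a = x then (1:ℝ) else 0)]
    simp [mul_comm]
  let b0 : Xh := Classical.arbitrary Xh
  let Q : X → Xh → ℝ := fun x b => if P x = 0 then (if b = b0 then 1 else 0) else J x b / P x
  have hPQ : ∀ x b, P x * Q x b = J x b := by
    intro x b
    simp only [Q]
    by_cases h : P x = 0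
    · have := hJm x
      rw [h] at this
      rw [h, zero_mul]
      exact ((Finset.sum_eq_zero_iff_of_nonneg fun b _ => hJ0 x b).mp this b
        (Finset.mem_univ b)).symm
    · rw [if_neg h]; field_simp
  refine ⟨Q, fun x => ⟨fun b => ?_, ?_⟩, fun h => ?_⟩
  · simp only [Q]
    split_ifs
    · norm_num
    · norm_num
    · exact div_nonneg (hJ0 x b) (hP.1 x)
  · simp only [Q]
    by_cases h : P x = 0
    · simp [h]
    · simp only [if_neg h]
      rw [← Finset.sum_div, hJm, div_self h]
  · simp_rw [hPQ]
    exact hJ h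

lemma one_shot_converse {P : X → ℝ} (hP : IsDist P) {n M : ℕ} (hn : 1 ≤ n) (hM : 0 < M)
    (enc : (Fin n → X) → Fin M → ℝ) (henc : IsChannel enc) (c : Fin M → Fin n → Xh) 
    {Q : X → Xh → ℝ} (hQ : IsChannel Q) (hh : ∀ h : X → Xh → ℝ,
      ∑ x, ∑ b, P x * Q x b * h x b
        = (∑ xs, ∑ m, iid P n xs * enc xs m * ∑ t, h (xs t) (c m t)) / n) :
    mutInf (fun p : X × Xh => P p.1 * Q p.1 p.2) ≤ Real.logb 2 M / n := by
  classical
  have hn' : (0:ℝ) < n := by exact_mod_cast hn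
  have hM' : (0:ℝ) < M := by exact_mod_cast hM
  have hl : 0 < Real.log 2 := Real.log_pos (by norm_num)
  rw [mutInf_eq hP hQ, hh]
  refine div_le_div_of_nonneg_right ?_ hn'.le
  -- the weights vanish where the likelihood ratio vanishes
  have hsupp : ∀ xs m, iid P n xs * enc xs m ≠ 0 → ∀ t, lr P Q (xs t) (c m t) ≠ 0 := by
    intro xs m hne t h0
    have hz := hh (fun x b => if lr P Q x b = 0 then 1 else 0)
    have hL : ∑ x, ∑ b, P x * Q x b * (if lr P Q x b = 0 then (1:ℝ) else 0) = 0 := by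
      refine Finset.sum_eq_zero fun x _ => Finset.sum_eq_zero fun b _ => ?_
      split_ifs with h
      · by_cases hx : P x = 0
        · simp [hx]
        · rw [← lr_mul hP hQ x b hx, h]; simp
      · simp
    rw [hL] at hz
    have hz2 := (div_eq_zero_iff.mp hz.symm).resolve_right hn'.ne'
    have hnn : ∀ xs m, 0 ≤ iid P n xs * enc xs m *
        ∑ t, (if lr P Q (xs t) (c m t) = 0 then (1:ℝ) else 0) := fun xs m =>
      mul_nonneg (mul_nonneg (iid_nonneg hP n xs) ((henc xs).1 m))
        (Finset.sum_nonneg fun t _ => by split_ifs <;> norm_num)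
    have h1 := (Finset.sum_eq_zero_iff_of_nonneg fun xs _ =>
      Finset.sum_nonneg fun m _ => hnn xs m).mp hz2 xs (Finset.mem_univ _)
    have h2 := (Finset.sum_eq_zero_iff_of_nonneg fun m _ => hnn xs m).mp h1 m (Finset.mem_univ _)
    have h3 := (mul_eq_zero.mp h2).resolve_left hne
    have h4 := (Finset.sum_eq_zero_iff_of_nonneg fun t _ => by split_ifs <;> norm_num).mp h3 t
      (Finset.mem_univ _)
    rw [if_pos h0] at h4
    exact one_ne_zero h4
  have hpt : ∀ xs m, iid P n xs * enc xs m * ∑ t, Real.logb 2 (lr P Q (xs t) (c m t))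
      ≤ iid P n xs * enc xs m * (Real.logb 2 M - 1 / Real.log 2)
        + iid P n xs * (∏ t, lr P Q (xs t) (c m t)) / (M * Real.log 2) := by
    intro xs m
    have hg0 : 0 ≤ ∏ t, lr P Q (xs t) (c m t) :=
      Finset.prod_nonneg fun t _ => lr_nonneg hP hQ _ _
    have hi := iid_nonneg hP n xs
    by_cases h0 : iid P n xs * enc xs m = 0
    · rw [h0, zero_mul, zero_mul, zero_add]
      positivity
    · have hne : ∏ t, lr P Q (xs t) (c m t) ≠ 0 :=
        Finset.prod_ne_zero_iff.mpr fun t _ => hsupp xs m h0 t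
      have hgp : 0 < ∏ t, lr P Q (xs t) (c m t) := lt_of_le_of_ne hg0 (Ne.symm hne)
      rw [← Real.logb_prod _ _ (fun t _ => hsupp xs m h0 t)]
      set G := ∏ t, lr P Q (xs t) (c m t) with hG
      have hlog : Real.logb 2 G ≤ Real.logb 2 M - 1 / Real.log 2 + G / (M * Real.log 2) := by
        have h1 := Real.log_le_sub_one_of_pos (div_pos hgp hM')
        rw [Real.log_div hne hM'.ne'] at h1
        unfold Real.logb
        have e : Real.log M / Real.log 2 - 1 / Real.log 2 + G / (M * Real.log 2)
            = (Real.log M - 1 + G / M) / Real.log 2 := by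
          field_simp
        rw [e]
        apply div_le_div_of_nonneg_right _ hl.le
        linarith
      have henc1 : enc xs m ≤ 1 := by
        rw [← (henc xs).2]
        exact Finset.single_le_sum (fun m _ => (henc xs).1 m) (Finset.mem_univ m)
      have h2 := mul_le_mul_of_nonneg_left hlog (mul_nonneg hi ((henc xs).1 m))
      have h3 : iid P n xs * enc xs m * (G / (M * Real.log 2))
          ≤ iid P n xs * G / (M * Real.log 2) := by
        have : 0 ≤ iid P n xs * (G / (M * Real.log 2)) := by positivity
        have h4 := mul_le_mul_of_nonneg_left henc1 this
        calc _ = iid P n xs * (G / (M * Real.log 2)) * enc xs m := by ring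
          _ ≤ _ := h4
          _ = _ := by ring
      linarith
  refine le_trans (Finset.sum_le_sum fun xs _ => Finset.sum_le_sum fun m _ => hpt xs m) ?_
  simp_rw [Finset.sum_add_distrib, ← Finset.sum_mul, ← Finset.mul_sum, (henc _).2, mul_one]
  rw [iid_sum hP, one_mul]
  have hE : ∑ xs, ∑ m, iid P n xs * (∏ t, lr P Q (xs t) (c m t)) / (M * Real.log 2)
      ≤ 1 / Real.log 2 := by
    rw [Finset.sum_comm]
    have h1 : ∀ m, ∑ xs, iid P n xs * (∏ t, lr P Q (xs t) (c m t)) / (M * Real.log 2)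
        ≤ 1 / (M * Real.log 2) := by
      intro m
      rw [← Finset.sum_div]
      refine div_le_div_of_nonneg_right ?_ (by positivity)
      unfold iid
      simp_rw [← Finset.prod_mul_distrib]
      rw [sum_prod_fun (fun t a => P a * lr P Q a (c m t))]
      refine Finset.prod_le_one (fun t _ => Finset.sum_nonneg fun x _ =>
        mul_nonneg (hP.1 x) (lr_nonneg hP hQ _ _)) fun t _ => ?_
      unfold lr
      simp_rw [← mul_div_assoc]
      rw [← Finset.sum_div]
      exact div_self_le_one _
    refine le_trans (Finset.sum_le_sum fun m _ => h1 m) ?_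
    simp only [Finset.sum_const, Finset.card_univ, Fintype.card_fin, nsmul_eq_mul]
    apply le_of_eq
    field_simp
  linarith

lemma continuous_ent {A : Type*} [Fintype A] : Continuous (fun P : A → ℝ => ent P) := by
  unfold ent
  have h : Continuous (fun x : ℝ => x * Real.logb 2 x) := by
    have := Real.continuous_mul_log.div_const (Real.log 2)
    refine this.congr fun x => ?_
    unfold Real.logb; ring
  refine Continuous.neg (continuous_finsetSum _ fun a _ => ?_)
  exact h.comp (continuous_apply a)

lemma continuous_mutInf (P : X → ℝ) :
    Continuous (fun Q : X → Xh → ℝ => mutInf fun p : X × Xh => P p.1 * Q p.1 p.2) := by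
  unfold mutInf
  refine Continuous.sub (Continuous.add ?_ ?_) ?_
  · exact continuous_ent.comp (by fun_prop : Continuous fun (Q : X → Xh → ℝ) (a : X) =>
      ∑ b, P a * Q a b)
  · exact continuous_ent.comp (by fun_prop : Continuous fun (Q : X → Xh → ℝ) (b : Xh) =>
      ∑ a, P a * Q a b)
  · exact continuous_ent.comp (by fun_prop : Continuous fun (Q : X → Xh → ℝ) (p : X × Xh) =>
      P p.1 * Q p.1 p.2)

lemma isCompact_channels_s10 : IsCompact {Q : X → Xh → ℝ | IsChannel Q} := by
  have hbox : IsCompact (Set.pi Set.univ (fun _ : X => Set.pi Set.univ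
      (fun _ : Xh => Set.Icc (0:ℝ) 1))) :=
    isCompact_univ_pi fun _ => isCompact_univ_pi fun _ => isCompact_Icc
  refine hbox.of_isClosed_subset ?_ ?_
  · have : {Q : X → Xh → ℝ | IsChannel Q}
        = ⋂ x, ((⋂ b, {Q : X → Xh → ℝ | 0 ≤ Q x b}) ∩ {Q | ∑ b, Q x b = 1}) := by
      ext Q
      simp [IsChannel, IsDist]
    rw [this]
    refine isClosed_iInter fun x => IsClosed.inter (isClosed_iInter fun b => ?_) ?_
    · exact isClosed_le continuous_const (by fun_prop)
    · exact isClosed_eq (by fun_prop) continuous_const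
  · intro Q hQ x _ b _
    refine ⟨(hQ x).1 b, ?_⟩
    rw [← (hQ x).2]
    exact Finset.single_le_sum (fun b _ => (hQ x).1 b) (Finset.mem_univ b)

lemma exists_limit_channel (P : X → ℝ) (d : X → Xh → ℝ) (D R : ℝ)
    (h : ∀ ε > (0:ℝ), ∃ Q : X → Xh → ℝ, IsChannel Q ∧ ∑ x, ∑ b, P x * Q x b * d x b ≤ D + ε ∧
      mutInf (fun p : X × Xh => P p.1 * Q p.1 p.2) ≤ R + ε) :
    ∃ Q : X → Xh → ℝ, IsChannel Q ∧ ∑ x, ∑ b, P x * Q x b * d x b ≤ D ∧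
      mutInf (fun p : X × Xh => P p.1 * Q p.1 p.2) ≤ R := by
  let F : (X → Xh → ℝ) → ℝ := fun Q => max (∑ x, ∑ b, P x * Q x b * d x b - D)
    ((mutInf fun p : X × Xh => P p.1 * Q p.1 p.2) - R)
  have hF : Continuous F := by
    refine Continuous.max ?_ ((continuous_mutInf P).sub continuous_const)
    fun_prop
  obtain ⟨Q1, hQ1, -⟩ := h 1 one_pos
  obtain ⟨Q, hQ, hmin⟩ := isCompact_channels_s10.exists_isMinOn ⟨Q1, hQ1⟩ hF.continuousOn
  have hle : F Q ≤ 0 := by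
    refine le_of_forall_pos_le_add fun ε hε => ?_
    obtain ⟨Q', hQ', h1, h2⟩ := h ε hε
    refine le_trans (hmin hQ') ?_
    exact max_le (by linarith) (by linarith)
  have h1 := (max_le_iff.mp hle).1
  have h2 := (max_le_iff.mp hle).2
  exact ⟨Q, hQ, by linarith, by linarith⟩

lemma channel_of_achievable {P : X → ℝ} (hP : IsDist P) (e : X → Y → ℝ) (d : X → Xh → ℝ)
    (D E R : ℝ) (y : Y) (hy : ∑ x, P x * e x y ≤ E)
    (h : Achievable P d (AvgClass P e E) D R) :
    ∃ Q : X → Xh → ℝ, IsChannel Q ∧ ∑ x, ∑ b, P x * Q x b * d x b ≤ D ∧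
      mutInf (fun p : X × Xh => P p.1 * Q p.1 p.2) ≤ R := by
  classical
  refine exists_limit_channel P d D R fun ε hε => ?_
  obtain ⟨n0, C, hC⟩ := h ε hε
  obtain ⟨hrate, hdist⟩ := hC (n0 + 1) (Nat.le_succ _)
  let W : ChannelSeq X Y := fun n _ ys => if ys = (fun _ => y) then 1 else 0
  have hW : W ∈ AvgClass P e E := by
    refine ⟨fun n xs => ⟨fun ys => ?_, ?_⟩, fun n hn => ?_⟩
    · simp only [W]; split_ifs <;> norm_num
    · simp [W]
    · have hn' : (0:ℝ) < n := by exact_mod_cast hn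
      refine le_trans (le_of_eq ?_) hy
      unfold avgSideDist
      have h1 : ∀ xs : Fin n → X, ∑ ys, iid P n xs * W n xs ys * dseq e n xs ys
          = (∑ t, iid P n xs * e (xs t) y) / n := by
        intro xs
        rw [Finset.sum_eq_single (fun _ => y)]
        · simp only [W, dseq, if_pos]
          rw [← Finset.mul_sum]; ring
        · intro ys _ hys; simp [W, hys]
        · simp
      simp_rw [h1]
      rw [← Finset.sum_div, Finset.sum_comm]
      simp_rw [fun t => iid_marg hP n t (fun a => e a y)]
      simp only [Finset.sum_const, Finset.card_univ, Fintype.card_fin, nsmul_eq_mul]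
      field_simp
  have hd := hdist W hW
  set n := n0 + 1 with hn
  have hn1 : 1 ≤ n := by omega
  let c : Fin (C n).M → Fin n → Xh := fun m => (C n).dec m (fun _ => y)
  obtain ⟨Q, hQ, hh⟩ := single_letter hP hn1 (C n).enc (C n).enc_channel c
  refine ⟨Q, hQ, ?_, ?_⟩
  · rw [hh]
    refine le_trans (le_of_eq ?_) hd
    unfold Code.expDist
    rw [Finset.sum_div]
    refine Finset.sum_congr rfl fun xs _ => ?_
    rw [Finset.sum_eq_single (fun _ => y)]
    · rw [Finset.sum_div]
      refine Finset.sum_congr rfl fun m _ => ?_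
      simp only [W, dseq, if_pos, c]
      ring
    · intro ys _ hys
      simp [W, hys]
    · simp
  · exact le_trans (one_shot_converse hP hn1 (C n).Mpos _ (C n).enc_channel c hQ hh) hrate

end Conv

/-- If `E ≥ E_* := min_{y} ∑_x P_X(x) e(x,y)`, then `R_a(D|E) = R(D)`,
the classical rate-distortion function of the source `P_X` (without side-information). -/
theorem Ra_eq_RD_of_large_E
    {X Y Xh : Type*} [Fintype X] [Fintype Y] [Fintype Xh]
    [Nonempty X] [Nonempty Y] [Nonempty Xh]
    (P : X → ℝ) (hP : IsDist P)
    (e : X → Y → ℝ) (he0 : ∀ x y, 0 ≤ e x y) (heZ : ∀ x, ∃ y, e x y = 0)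
    (d : X → Xh → ℝ) (hd0 : ∀ x xh, 0 ≤ d x xh) (hdZ : ∀ x, ∃ xh, d x xh = 0)
    (D E : ℝ) (hD : 0 ≤ D)
    (hE : sInf (Set.range fun y : Y => ∑ x, P x * e x y) ≤ E) :
    Ra P e d D E = RD P d D := by
  classical
  obtain ⟨y, hy⟩ : ∃ y, ∑ x, P x * e x y ≤ E := by
    obtain ⟨y, hy⟩ := (Set.range_nonempty fun y : Y => ∑ x, P x * e x y).csInf_mem
      (Set.finite_range _)
    exact ⟨y, le_trans (le_of_eq hy) hE⟩
  have hbdd : BddBelow ((fun Q : X → Xh → ℝ => mutInf fun p : X × Xh => P p.1 * Q p.1 p.2) ''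
      {Q | IsChannel Q ∧ (∑ x, ∑ xh, P x * Q x xh * d x xh) ≤ D}) := by
    refine ⟨0, ?_⟩
    rintro _ ⟨Q, hQ, rfl⟩
    exact mutInf_nonneg hP hQ.1
  have hconv : ∀ R ∈ {R | Achievable P d (AvgClass P e E) D R}, RD P d D ≤ R := by
    intro R hR
    obtain ⟨Q, hQ, hQD, hQR⟩ := channel_of_achievable hP e d D E R y hy hR
    exact le_trans (csInf_le hbdd ⟨Q, ⟨hQ, hQD⟩, rfl⟩) hQR
  have hach : ∀ Q : X → Xh → ℝ, IsChannel Q → (∑ x, ∑ xh, P x * Q x xh * d x xh) ≤ D →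
      Achievable P d (AvgClass P e E) D (mutInf fun p : X × Xh => P p.1 * Q p.1 p.2) :=
    fun Q hQ hQD => achievable_of_channel hP e d hd0 D E hD hQ hQD
  choose z hz using hdZ
  have hQ0 : IsChannel (fun (x : X) (b : Xh) => if b = z x then (1:ℝ) else 0) := by
    intro x
    refine ⟨fun b => ?_, by simp⟩
    dsimp only
    split_ifs <;> norm_num
  have hQ0D : ∑ x, ∑ b, P x * (if b = z x then (1:ℝ) else 0) * d x b ≤ D := by
    refine le_trans (le_of_eq ?_) hD
    refine Finset.sum_eq_zero fun x _ => Finset.sum_eq_zero fun b _ => ?_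
    split_ifs with h
    · rw [h, hz]; simp
    · simp
  apply le_antisymm
  · refine le_csInf ⟨_, _, ⟨hQ0, hQ0D⟩, rfl⟩ ?_
    rintro _ ⟨Q, hQ, rfl⟩
    exact csInf_le ⟨RD P d D, hconv⟩ (hach Q hQ.1 hQ.2)
  · exact le_csInf ⟨_, hach _ hQ0 hQ0D⟩ hconv

end UWZ
end
end
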